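/- Let (s, ⟨·,·⟩) be a solsoliton with Ric = cI + D, c < 0, D a derivation of s, with nilradical n and a = n^⊥, and let Ric₁ be the Ricci operator of (n, ⟨·,·⟩|_{n×n}) with D₁ := Ric₁ - cI. Then the center z(s) of s is contained in n, and ⟨DX, X⟩ = ⟨D₁X, X⟩ for every X ∈ z(s). In particular, if D₁ is positive definite, then DX ≠ 0 for every nonzero X ∈ z(s), i.e. the derivation D of a solsoliton is injective on the center of s. -/

import Mathlib

noncomputable section

open scoped RealInnerProductSpace

/-! ### Lie-algebraic notions for a bracket given as a bundled bilinear map -/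

section Alg

variable {E : Type*} [AddCommGroup E] [Module ℝ E]

/-- `μ` is a Lie bracket: alternating and satisfying the (Leibniz form of the) Jacobi identity. -/
def IsLieBracket (μ : E →ₗ[ℝ] E →ₗ[ℝ] E) : Prop :=
  (∀ X, μ X X = 0) ∧ ∀ X Y Z, μ X (μ Y Z) = μ (μ X Y) Z + μ Y (μ X Z)

/-- `D` is a derivation of the algebra `(E, μ)`. -/
def IsDeriv (μ : E →ₗ[ℝ] E →ₗ[ℝ] E) (D : E →ₗ[ℝ] E) : Prop :=
  ∀ X Y, D (μ X Y) = μ (D X) Y + μ X (D Y)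

/-- The subspace spanned by brackets of elements of `p` and `q`. -/
def bracketSpan (μ : E →ₗ[ℝ] E →ₗ[ℝ] E) (p q : Submodule ℝ E) : Submodule ℝ E :=
  Submodule.span ℝ {z | ∃ x ∈ p, ∃ y ∈ q, μ x y = z}

/-- Derived series of `(E, μ)`. -/
def derSeries (μ : E →ₗ[ℝ] E →ₗ[ℝ] E) : ℕ → Submodule ℝ E
  | 0 => ⊤
  | k + 1 => bracketSpan μ (derSeries μ k) (derSeries μ k)

/-- `(E, μ)` is a solvable Lie algebra. -/
def IsSolvableB (μ : E →ₗ[ℝ] E →ₗ[ℝ] E) : Prop := ∃ k, derSeries μ k = ⊥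

/-- Lower central series of the subalgebra `p` of `(E, μ)`. -/
def lcsOn (μ : E →ₗ[ℝ] E →ₗ[ℝ] E) (p : Submodule ℝ E) : ℕ → Submodule ℝ E
  | 0 => p
  | k + 1 => bracketSpan μ p (lcsOn μ p k)

/-- The subalgebra `p` of `(E, μ)` is a nilpotent Lie algebra. -/
def IsNilpotentOn (μ : E →ₗ[ℝ] E →ₗ[ℝ] E) (p : Submodule ℝ E) : Prop := ∃ k, lcsOn μ p k = ⊥

/-- `p` is an ideal of `(E, μ)`. -/
def IsIdeal (μ : E →ₗ[ℝ] E →ₗ[ℝ] E) (p : Submodule ℝ E) : Prop := ∀ X : E, ∀ Y ∈ p, μ X Y ∈ p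

/-- `p` is the nilradical (maximal nilpotent ideal) of `(E, μ)`. -/
def IsNilradical (μ : E →ₗ[ℝ] E →ₗ[ℝ] E) (p : Submodule ℝ E) : Prop :=
  IsIdeal μ p ∧ IsNilpotentOn μ p ∧ ∀ q, IsIdeal μ q → IsNilpotentOn μ q → q ≤ p

/-- The natural action `π(f)μ` of `f ∈ End(E)` on bilinear maps:
`(π(f)μ)(X,Y) = f(μ(X,Y)) - μ(fX,Y) - μ(X,fY)`. -/
def piAct (f : E →ₗ[ℝ] E) (μ : E →ₗ[ℝ] E →ₗ[ℝ] E) : E →ₗ[ℝ] E →ₗ[ℝ] E :=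
  (LinearMap.llcomp ℝ E E E f) ∘ₗ μ - μ ∘ₗ f - (LinearMap.lcomp ℝ E f) ∘ₗ μ

/-- The center of `(E, μ)`. -/
def centerB (μ : E →ₗ[ℝ] E →ₗ[ℝ] E) : Submodule ℝ E where
  carrier := {X | μ X = 0}
  add_mem' := by intro a b ha hb; simp only [Set.mem_setOf_eq, map_add] at *; rw [ha, hb, add_zero]
  zero_mem' := by simp only [Set.mem_setOf_eq, map_zero]
  smul_mem' := by intro c a ha; simp only [Set.mem_setOf_eq, map_smul] at *; rw [ha, smul_zero]

end Alg

/-! ### Metric notions -/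

section MetricDefs

variable {E : Type*} [NormedAddCommGroup E] [InnerProductSpace ℝ E] [FiniteDimensional ℝ E]

/-- The transpose of an operator with respect to the inner product. -/
def transp (f : E →ₗ[ℝ] E) : E →ₗ[ℝ] E := LinearMap.adjoint f

/-- The symmetric part `S(f) = (f + fᵗ)/2` of an operator. -/
def symPart (f : E →ₗ[ℝ] E) : E →ₗ[ℝ] E := (1 / 2 : ℝ) • (f + transp f)

variable (E) in
/-- A fixed orthonormal basis of `E`. -/
def stdONB : OrthonormalBasis (Fin (Module.finrank ℝ E)) ℝ E := stdOrthonormalBasis ℝ E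

/-- The operator `R` appearing in the formula for the Ricci operator of a metric Lie algebra:
`⟨R X, X⟩ = -(1/2) Σ ⟨[X,Xᵢ],Xⱼ⟩² + (1/4) Σ ⟨[Xᵢ,Xⱼ],X⟩²` for any orthonormal basis `{Xᵢ}`. -/
def Rop (μ : E →ₗ[ℝ] E →ₗ[ℝ] E) : E →ₗ[ℝ] E :=
  (-(1 / 2 : ℝ)) • ∑ i, (transp (μ (stdONB E i))) ∘ₗ (μ (stdONB E i))
    + (1 / 4 : ℝ) • ∑ i, (μ (stdONB E i)) ∘ₗ (transp (μ (stdONB E i)))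

/-- The symmetric operator `B` defined by the Killing form: `⟨B X, X⟩ = tr((ad X)²)`. -/
def Bop (μ : E →ₗ[ℝ] E →ₗ[ℝ] E) : E →ₗ[ℝ] E :=
  ∑ i, (((LinearMap.trace ℝ E) ∘ₗ (LinearMap.lcomp ℝ E (μ (stdONB E i))) ∘ₗ μ).smulRight
    (stdONB E i))

/-- The mean curvature vector `H`, characterized by `⟨H, X⟩ = tr (ad X)`. -/
def meanCurv (μ : E →ₗ[ℝ] E →ₗ[ℝ] E) : E :=
  ∑ i, (LinearMap.trace ℝ E (μ (stdONB E i))) • (stdONB E i : E)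

/-- The Ricci operator `Ric = R - (1/2) B - S(ad H)` of a metric Lie algebra. -/
def Ric (μ : E →ₗ[ℝ] E →ₗ[ℝ] E) : E →ₗ[ℝ] E :=
  Rop μ - (1 / 2 : ℝ) • Bop μ - symPart (μ (meanCurv μ))

/-- `(E, μ, ⟨⬝,⬝⟩)` is a solsoliton: `Ric = c I + D` for some `c ∈ ℝ` and derivation `D`. -/
def IsSolsoliton (μ : E →ₗ[ℝ] E →ₗ[ℝ] E) : Prop :=
  ∃ (c : ℝ) (D : E →ₗ[ℝ] E), IsDeriv μ D ∧ Ric μ = c • LinearMap.id + D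

/-- The natural inner product on bilinear maps, `⟨μ,ν⟩ = Σ ⟨μ(Xᵢ,Xⱼ), ν(Xᵢ,Xⱼ)⟩`. -/
def binner (μ ν : E →ₗ[ℝ] E →ₗ[ℝ] E) : ℝ :=
  ∑ i, ∑ j, ⟪μ (stdONB E i) (stdONB E j), ν (stdONB E i) (stdONB E j)⟫

/-- Orthogonal projection onto a subspace, as an endomorphism of `E`. -/
def projL (p : Submodule ℝ E) : E →ₗ[ℝ] E :=
  p.subtype ∘ₗ (Submodule.orthogonalProjectionOnto p).toLinearMap

/-- An orthonormal basis of the subspace `p`, as a family of vectors of `E`. -/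
def onbOf (p : Submodule ℝ E) : Fin (Module.finrank ℝ ↥p) → E :=
  fun i => ((stdOrthonormalBasis ℝ ↥p) i : E)

/-- The restriction `ad X |_p` of `ad X` to the subspace `p`, as an endomorphism of `E`
(it kills `pᗮ`). -/
def adOn (μ : E →ₗ[ℝ] E →ₗ[ℝ] E) (p : Submodule ℝ E) (X : E) : E →ₗ[ℝ] E :=
  (μ X) ∘ₗ projL p

/-- The Ricci operator of the restricted metric Lie algebra `(p, μ|ₚ, ⟨⬝,⬝⟩|ₚ)`, for `p` a
bracket-closed subspace, realized as an endomorphism of `E` killing `pᗮ`.  (For `p` nilpotent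
this is the full Ricci operator of `p`.) -/
def RopOn (μ : E →ₗ[ℝ] E →ₗ[ℝ] E) (p : Submodule ℝ E) : E →ₗ[ℝ] E :=
  (-(1 / 2 : ℝ)) • ∑ i, (transp (adOn μ p (onbOf p i))) ∘ₗ (adOn μ p (onbOf p i))
    + (1 / 4 : ℝ) • ∑ i, (adOn μ p (onbOf p i)) ∘ₗ (transp (adOn μ p (onbOf p i)))

/-- The metric nilpotent Lie algebra `(p, μ|ₚ, ⟨⬝,⬝⟩|ₚ)` is a nilsoliton with Ricci operator
`c I + D₁`, where `D₁` is (induced by) a derivation of `p`. -/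
def IsNilsolitonOn (μ : E →ₗ[ℝ] E →ₗ[ℝ] E) (p : Submodule ℝ E) (c : ℝ) (D₁ : E →ₗ[ℝ] E) :
    Prop :=
  (∀ X ∈ p, D₁ X ∈ p) ∧ (∀ X ∈ p, ∀ Y ∈ p, D₁ (μ X Y) = μ (D₁ X) Y + μ X (D₁ Y)) ∧
    ∀ X ∈ p, RopOn μ p X = c • X + D₁ X

end MetricDefs

/-! ### Real filtrations and adapted bases -/

section Filtrations

universe v

/-- A decreasing, exhaustive and separated filtration indexed by `ℝ` with finitely many jumps,
continuous from the left. -/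
structure IsFil {V : Type v} [AddCommGroup V] [Module ℂ V] (F : ℝ → Submodule ℂ V) : Prop where
  anti : Antitone F
  top : ∃ r, F r = ⊤
  jumps : ∃ T : Finset ℝ, ∀ r, ∀ x ∈ F r, x ≠ 0 → ∃ t ∈ T, r ≤ t ∧ x ∈ F t

/-- The filtration attached to a weighted basis. -/
def fil {V : Type v} [AddCommGroup V] [Module ℂ V] {ι : Type*} (b : Module.Basis ι ℂ V)
    (u : ι → ℝ) (r : ℝ) : Submodule ℂ V where
  carrier := {x | ∀ i, b.repr x i ≠ 0 → r ≤ u i}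
  add_mem' := by
    intro x y hx hy i hi
    by_cases h : b.repr x i = 0
    · refine hy i fun h' => hi ?_
      simp [h, h']
    · exact hx i h
  zero_mem' := by intro i hi; simp at hi
  smul_mem' := by
    intro c x hx i hi
    refine hx i fun h => hi ?_
    simp [h]

variable {V : Type v} [AddCommGroup V] [Module ℂ V]

lemma mem_fil {ι : Type*} {b : Module.Basis ι ℂ V} {u : ι → ℝ} {r : ℝ} {x : V} :
    x ∈ fil b u r ↔ ∀ i, b.repr x i ≠ 0 → r ≤ u i := Iff.rfl

lemma basis_mem_fil {ι : Type*} {b : Module.Basis ι ℂ V} {u : ι → ℝ} {r : ℝ} {i : ι} :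
    b i ∈ fil b u r ↔ r ≤ u i := by
  rw [mem_fil]
  constructor
  · intro h; exact h i (by simp)
  · intro h j hj
    by_cases hij : i = j
    · exact hij ▸ h
    · exact absurd (by simp [hij]) hj

lemma fil_le {ι : Type*} [Fintype ι] {b : Module.Basis ι ℂ V} {u : ι → ℝ} {r : ℝ}
    {p : Submodule ℂ V} (h : ∀ i, r ≤ u i → b i ∈ p) : fil b u r ≤ p := by
  intro x hx
  rw [← b.sum_repr x]
  refine Submodule.sum_mem _ fun i _ => ?_
  by_cases hi : b.repr x i = 0
  · simp [hi]
  · exact p.smul_mem _ (h i (hx i hi))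

lemma isFil_fil {ι : Type*} [Fintype ι] (b : Module.Basis ι ℂ V) (u : ι → ℝ) :
    IsFil (fil b u) where
  anti := fun r s hrs x hx i hi => hrs.trans (hx i hi)
  top := by
    classical
    obtain ⟨r, hr⟩ := (Finset.univ.image u).bddBelow
    exact ⟨r, eq_top_iff.2 fun x _ i _ => hr (by simp)⟩
  jumps := by
    classical
    refine ⟨Finset.univ.image u, fun r x hx hx0 => ?_⟩
    have hne : (Finset.univ.filter fun i => b.repr x i ≠ 0).Nonempty := by
      rw [Finset.filter_nonempty_iff]
      by_contra h
      push Not at h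
      exact hx0 (b.repr.map_eq_zero_iff.1 (Finsupp.ext fun i => h i (Finset.mem_univ i)))
    obtain ⟨i, hi, hmin⟩ := Finset.exists_min_image _ u hne
    refine ⟨u i, by simp, hx i (Finset.mem_filter.1 hi).2, fun j hj => ?_⟩
    exact hmin j (Finset.mem_filter.2 ⟨Finset.mem_univ _, hj⟩)

lemma IsFil.exists_last {F : ℝ → Submodule ℂ V} (hF : IsFil F) {P : Submodule ℂ V} (hP : P ≠ ⊤) :
    ∃ r, ¬ F r ≤ P ∧ ∀ s, r < s → F s ≤ P := by
  classical
  obtain ⟨T, hT⟩ := hF.jumps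
  obtain ⟨r, hr⟩ := hF.top
  have key : ∀ s, ¬ F s ≤ P → ∃ t ∈ T, s ≤ t ∧ ¬ F t ≤ P := by
    intro s hs
    obtain ⟨x, hx, hxP⟩ := SetLike.not_le_iff_exists.1 hs
    obtain ⟨t, ht, hst, hxt⟩ := hT s x hx (by rintro rfl; exact hxP P.zero_mem)
    exact ⟨t, ht, hst, fun h => hxP (h hxt)⟩
  have hne : (T.filter fun t => ¬ F t ≤ P).Nonempty := by
    obtain ⟨t, ht, -, h⟩ := key r (by rw [hr]; exact fun h => hP (top_le_iff.1 h))
    exact ⟨t, Finset.mem_filter.2 ⟨ht, h⟩⟩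
  obtain ⟨r₀, hr₀, hmax⟩ := Finset.exists_max_image _ id hne
  refine ⟨r₀, (Finset.mem_filter.1 hr₀).2, fun s hs => ?_⟩
  by_contra h
  obtain ⟨t, ht, hst, h'⟩ := key s h
  exact absurd (hmax t (Finset.mem_filter.2 ⟨ht, h'⟩)) (not_le.2 (hs.trans_le hst))

lemma IsFil.exists_maximal_step [FiniteDimensional ℂ V] [Nontrivial V] {F : ℝ → Submodule ℂ V}
    (hF : IsFil F) :
    ∃ (q r₀ : ℝ), F q ≠ ⊤ ∧ F r₀ = ⊤ ∧ ∀ s, r₀ < s → F s ≤ F q := by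
  have hne : ({P | ∃ r, P = F r ∧ F r ≠ ⊤} : Set (Submodule ℂ V)).Nonempty := by
    obtain ⟨r, hr, h⟩ := hF.exists_last (P := (⊥ : Submodule ℂ V)) bot_ne_top
    refine ⟨_, r + 1, rfl, fun h' => ?_⟩
    have := h (r + 1) (by linarith)
    rw [h'] at this
    exact bot_ne_top (le_bot_iff.1 this).symm
  obtain ⟨P, ⟨q, hPq, hq⟩, hmax⟩ := WellFounded.has_min
    (wellFounded_gt : WellFounded ((· > ·) : Submodule ℂ V → Submodule ℂ V → Prop)) _ hne
  have hle : ∀ r, F r ≠ ⊤ → F r ≤ F q := by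
    intro r hr
    rcases le_total q r with h | h
    · exact hF.anti h
    · by_contra hcon
      exact hmax (F r) ⟨r, rfl, hr⟩ (hPq ▸ lt_of_le_not_ge (hF.anti h) hcon)
  obtain ⟨r₀, hr₀, h⟩ := hF.exists_last hq
  exact ⟨q, r₀, hq, not_not.1 fun hcon => hr₀ (hle r₀ hcon), h⟩

lemma IsFil.comap {F : ℝ → Submodule ℂ V} (hF : IsFil F) (U : Submodule ℂ V) :
    IsFil fun r => (F r).comap U.subtype where
  anti := fun _ _ h => Submodule.comap_mono (hF.anti h)
  top := by
    obtain ⟨r, hr⟩ := hF.top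
    exact ⟨r, by simp [hr]⟩
  jumps := by
    obtain ⟨T, hT⟩ := hF.jumps
    refine ⟨T, fun r x hx hx0 => ?_⟩
    obtain ⟨t, ht, hrt, h⟩ := hT r x hx (by simpa using hx0)
    exact ⟨t, ht, hrt, h⟩

lemma mkFinCons_repr {n : ℕ} {U : Submodule ℂ V} {x : V} {b : Module.Basis (Fin n) ℂ U}
    {hli : ∀ (c : ℂ), ∀ y ∈ U, c • x + y = 0 → c = 0} {hsp : ∀ z : V, ∃ c : ℂ, z + c • x ∈ U}
    (c : ℂ) (y : U) :
    ⇑((Module.Basis.mkFinCons x b hli hsp).repr (c • x + (y : V))) = Fin.cons c (b.repr y) := by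
  have h : c • x + (y : V) = ∑ i, (Fin.cons c (b.repr y) : Fin (n + 1) → ℂ) i •
      Module.Basis.mkFinCons x b hli hsp i := by
    rw [Fin.sum_univ_succ]
    simp only [Module.Basis.coe_mkFinCons, Fin.cons_zero, Fin.cons_succ, Function.comp]
    congr 1
    have h := congrArg U.subtype (b.sum_repr y)
    rw [map_sum] at h
    exact h.symm
  rw [h, Module.Basis.repr_sum_self]

lemma fil_mkFinCons {n : ℕ} {U : Submodule ℂ V} {x : V} {b : Module.Basis (Fin n) ℂ U}
    {hli : ∀ (c : ℂ), ∀ y ∈ U, c • x + y = 0 → c = 0} {hsp : ∀ z : V, ∃ c : ℂ, z + c • x ∈ U}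
    {F : ℝ → Submodule ℂ V} (hF : Antitone F) {P : Submodule ℂ V} (hPU : P ≤ U) {s : ℝ}
    (hx : x ∈ F s) (hs : ∀ r, s < r → F r ≤ P) {u : Fin n → ℝ}
    (hu : ∀ r, (F r).comap U.subtype = fil b u r) (r : ℝ) :
    F r = fil (Module.Basis.mkFinCons x b hli hsp) (Fin.cons s u) r := by
  apply le_antisymm
  · intro z hz
    obtain ⟨c, hc⟩ := hsp z
    obtain ⟨y, rfl⟩ : ∃ y : U, z = (-c) • x + (y : V) := ⟨⟨_, hc⟩, by simp⟩
    rw [mem_fil, mkFinCons_repr]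
    by_cases hrs : r ≤ s
    · have hy : (y : V) ∈ F r := by
        have := (F r).sub_mem hz ((F r).smul_mem (-c) (hF hrs hx))
        simpa using this
      have hy' : y ∈ fil b u r := by rw [← hu]; exact hy
      intro i
      refine Fin.cases (fun _ => by simpa using hrs) (fun i hi => ?_) i
      simpa using hy' i (by simpa using hi)
    · have hU : (-c) • x + (y : V) ∈ U := hPU (hs r (not_le.1 hrs) hz)
      have hc0 : -c = 0 := hli (-c) (y - ((-c) • x + (y : V))) (U.sub_mem y.2 hU) (by abel)
      have hy' : y ∈ fil b u r := by
        rw [← hu]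
        simpa [hc0] using hz
      intro i
      refine Fin.cases (fun h => by simp [hc0] at h) (fun i hi => ?_) i
      simpa using hy' i (by simpa using hi)
  · refine fil_le fun i => ?_
    rw [Module.Basis.coe_mkFinCons]
    refine Fin.cases (fun h => ?_) (fun i h => ?_) i
    · exact hF (by simpa using h) hx
    · have : b i ∈ (F r).comap U.subtype := by
        rw [hu]; exact basis_mem_fil.2 (by simpa using h)
      simpa using this

end Filtrations

section Adapted

universe v

open Module.End in
theorem exists_adapted_eigenbasis (n : ℕ) : ∀ (V : Type v) [AddCommGroup V] [Module ℂ V]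
    [FiniteDimensional ℂ V], Module.finrank ℂ V = n → ∀ (S : Module.End ℂ V), S.IsSemisimple →
    ∀ F G : ℝ → Submodule ℂ V, IsFil F → IsFil G → (∀ r, ∀ x ∈ F r, S x ∈ F r) →
    (∀ r, ∀ x ∈ G r, S x ∈ G r) →
    ∃ (b : Module.Basis (Fin n) ℂ V) (l : Fin n → ℂ) (u w : Fin n → ℝ),
      (∀ i, S (b i) = l i • b i) ∧ (∀ r, F r = fil b u r) ∧ ∀ r, G r = fil b w r := by
  induction n with
  | zero =>
    intro V _ _ _ hn S hS F G hF hG hSF hSG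
    have := Module.finrank_zero_iff.1 hn
    exact ⟨Module.Basis.empty V, Fin.elim0, Fin.elim0, Fin.elim0, fun i => i.elim0,
      fun r => Subsingleton.elim _ _, fun r => Subsingleton.elim _ _⟩
  | succ n ih =>
    intro V _ _ _ hn S hS F G hF hG hSF hSG
    have : Nontrivial V := Module.nontrivial_of_finrank_pos (R := ℂ) (by omega)
    obtain ⟨q, r₀, hq, hr₀, hr₀'⟩ := hF.exists_maximal_step
    obtain ⟨s₀, hs₀, hs₀'⟩ := hG.exists_last hq
    have hSP : F q ∈ S.invtSubmodule := fun x hx => hSF q x hx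
    have hSGs : G s₀ ∈ S.invtSubmodule := fun x hx => hSG s₀ x hx
    have hinf : F q ⊓ G s₀ ∈ S.invtSubmodule := fun x hx => ⟨hSF q x hx.1, hSG s₀ x hx.2⟩
    obtain ⟨C, hCG, hC, hdisj, hsup⟩ := (isSemisimple_restrict_iff _ hSGs).1
      (hS.restrict hSGs) _ hinf inf_le_right
    have hCne : C ≠ ⊥ := by
      rintro rfl
      rw [sup_bot_eq] at hsup
      exact hs₀ (hsup ▸ inf_le_left)
    have : Nontrivial C := Submodule.nontrivial_iff_ne_bot.2 hCne
    obtain ⟨l₀, hl₀⟩ := exists_eigenvalue (LinearMap.restrict S hC)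
    obtain ⟨x', hx'⟩ := hl₀.exists_hasEigenvector
    obtain ⟨x, hx, hx0⟩ : ∃ x : V, (x ∈ C ∧ S x = l₀ • x) ∧ x ≠ 0 := by
      refine ⟨x', ⟨x'.2, ?_⟩, by simpa using hx'.2⟩
      exact congrArg Subtype.val hx'.apply_eq_smul
    have hxP : x ∉ F q := by
      intro h
      have := hdisj.le_bot ⟨⟨h, hCG hx.1⟩, hx.1⟩
      exact hx0 (by simpa using this)
    have hPx : F q ⊔ ℂ ∙ x ∈ S.invtSubmodule := by
      apply Sublattice.sup_mem hSP
      intro y hy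
      obtain ⟨a, rfl⟩ := Submodule.mem_span_singleton.1 hy
      simp only [Submodule.mem_comap, map_smul, hx.2]
      exact Submodule.smul_mem _ _ (Submodule.smul_mem _ _ (Submodule.mem_span_singleton_self x))
    obtain ⟨Q, hQ, hQc⟩ := isSemisimple_iff.1 hS _ hPx
    set U : Submodule ℂ V := F q ⊔ Q with hU
    have hUS : U ∈ S.invtSubmodule := Sublattice.sup_mem hSP hQ
    have hli : ∀ (c : ℂ), ∀ y ∈ U, c • x + y = 0 → c = 0 := by
      intro c y hy hxy
      obtain ⟨p, hp, z, hz, rfl⟩ := Submodule.mem_sup.1 hy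
      have hz0 : z = 0 := by
        have h1 : z = -(p + c • x) := by rw [eq_neg_iff_add_eq_zero, ← hxy]; abel
        have h2 : z ∈ F q ⊔ ℂ ∙ x := by
          rw [h1]
          exact Submodule.neg_mem _ (Submodule.add_mem_sup hp
            (Submodule.smul_mem _ _ (Submodule.mem_span_singleton_self x)))
        simpa using hQc.disjoint.le_bot ⟨h2, hz⟩
      by_contra hc
      apply hxP
      have : x = (-c⁻¹) • p := by
        have h1 : c • x = -p := by rw [eq_neg_iff_add_eq_zero, ← hxy, hz0, add_zero]
        rw [neg_smul, ← smul_neg, ← h1, smul_smul, inv_mul_cancel₀ hc, one_smul]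
      rw [this]
      exact Submodule.smul_mem _ _ hp
    have hsp : ∀ z : V, ∃ c : ℂ, z + c • x ∈ U := by
      intro z
      have hz : z ∈ (F q ⊔ ℂ ∙ x) ⊔ Q := by rw [hQc.sup_eq_top]; trivial
      obtain ⟨p, hp, y, hy, rfl⟩ := Submodule.mem_sup.1 hz
      obtain ⟨p, hp', w, hw, rfl⟩ := Submodule.mem_sup.1 hp
      obtain ⟨a, rfl⟩ := Submodule.mem_span_singleton.1 hw
      refine ⟨-a, ?_⟩
      have : p + a • x + y + -a • x = p + y := by simp; abel
      rw [this]
      exact Submodule.add_mem_sup hp' hy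
    have hdim : Module.finrank ℂ U = n := by
      have b := Module.finBasis ℂ U
      have := Module.finrank_eq_card_basis (Module.Basis.mkFinCons x b hli hsp)
      simp at this
      omega
    obtain ⟨b, l, u, w, hb, hbu, hbw⟩ := ih U hdim (LinearMap.restrict S hUS) (hS.restrict hUS) _ _
      (hF.comap U) (hG.comap U) (fun r y hy => hSF r y hy) (fun r y hy => hSG r y hy)
    refine ⟨Module.Basis.mkFinCons x b hli hsp, Fin.cons l₀ l, Fin.cons r₀ u, Fin.cons s₀ w,
      fun i => ?_, fun r => ?_, fun r => ?_⟩
    · rw [Module.Basis.coe_mkFinCons]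
      refine Fin.cases ?_ (fun i => ?_) i
      · simpa using hx.2
      · exact congrArg Subtype.val (hb i)
    · exact fil_mkFinCons hF.anti le_sup_left (by rw [hr₀]; trivial) hr₀' hbu r
    · exact fil_mkFinCons hG.anti le_sup_left (hCG hx.1) hs₀' hbw r

end Adapted

section AdaptedOrthonormal

universe v

theorem exists_adapted_orthonormalBasis (n : ℕ) : ∀ (W : Type v) [NormedAddCommGroup W]
    [InnerProductSpace ℂ W] [FiniteDimensional ℂ W], Module.finrank ℂ W = n →
    ∀ F : ℝ → Submodule ℂ W, IsFil F →
    ∃ (b : OrthonormalBasis (Fin n) ℂ W) (u : Fin n → ℝ), ∀ r, F r = fil b.toBasis u r := by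
  induction n with
  | zero =>
    intro W _ _ _ hn F hF
    have := Module.finrank_zero_iff.1 hn
    refine ⟨(Module.Basis.empty W).toOrthonormalBasis ⟨fun i => i.elim0, fun i => i.elim0⟩,
      Fin.elim0, fun r => Subsingleton.elim _ _⟩
  | succ n ih =>
    intro W _ _ _ hn F hF
    have : Nontrivial W := Module.nontrivial_of_finrank_pos (R := ℂ) (by omega)
    obtain ⟨q, r₀, hq, hr₀, hr₀'⟩ := hF.exists_maximal_step
    obtain ⟨x, hxq, hx⟩ : ∃ x ∈ (F q)ᗮ, ‖x‖ = 1 := by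
      obtain ⟨y, hy, hy0⟩ := Submodule.exists_mem_ne_zero_of_ne_bot
        (fun h => hq (Submodule.orthogonal_eq_bot_iff.1 h))
      refine ⟨((‖y‖⁻¹ : ℝ) : ℂ) • y, Submodule.smul_mem _ _ hy, ?_⟩
      rw [norm_smul]
      simp [norm_ne_zero_iff.2 hy0]
    set U : Submodule ℂ W := (ℂ ∙ x)ᗮ with hU
    have hxx : inner ℂ x x = 1 := by rw [inner_self_eq_norm_sq_to_K, hx]; simp
    have hmem : ∀ y, y ∈ U ↔ inner ℂ x y = 0 := fun y => Submodule.mem_orthogonal_singleton_iff_inner_right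
    have hli : ∀ (c : ℂ), ∀ y ∈ U, c • x + y = 0 → c = 0 := by
      intro c y hy h
      have := congrArg (inner ℂ x) h
      rw [inner_add_right, inner_smul_right, hxx, (hmem y).1 hy] at this
      simpa using this
    have hsp : ∀ z : W, ∃ c : ℂ, z + c • x ∈ U := by
      intro z
      refine ⟨-inner ℂ x z, ?_⟩
      rw [hmem, inner_add_right, inner_smul_right, hxx]
      ring
    have hPU : F q ≤ U := by
      intro y hy
      rw [hmem]
      exact Submodule.inner_left_of_mem_orthogonal hy hxq
    have hdim : Module.finrank ℂ U = n := by
      have b := Module.finBasis ℂ U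
      have := Module.finrank_eq_card_basis (Module.Basis.mkFinCons x b hli hsp)
      simp at this
      omega
    obtain ⟨b, u, hbu⟩ := ih U hdim _ (hF.comap U)
    have hcoe : ⇑(Module.Basis.mkFinCons x b.toBasis hli hsp) = Fin.cons x (fun i => (b i : W)) := by
      rw [Module.Basis.coe_mkFinCons]
      congr 1
    have hon : Orthonormal ℂ (Module.Basis.mkFinCons x b.toBasis hli hsp) := by
      rw [hcoe, orthonormal_iff_ite]
      intro i j
      have hb := orthonormal_iff_ite.1 b.orthonormal
      refine Fin.cases ?_ (fun i => ?_) i <;> refine Fin.cases ?_ (fun j => ?_) j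
      · simpa using hxx
      · simpa [Fin.succ_ne_zero, (Fin.succ_ne_zero _).symm] using (hmem _).1 (b j).2
      · have := (hmem _).1 (b i).2
        rw [inner_eq_zero_symm] at this
        simpa [Fin.succ_ne_zero] using this
      · have := hb i j
        rw [Submodule.coe_inner] at this
        simpa using this
    refine ⟨(Module.Basis.mkFinCons x b.toBasis hli hsp).toOrthonormalBasis hon, Fin.cons r₀ u,
      fun r => ?_⟩
    rw [Module.Basis.toBasis_toOrthonormalBasis]
    exact fil_mkFinCons hF.anti hPU (by rw [hr₀]; trivial) hr₀' hbu r

end AdaptedOrthonormal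

section Weights

universe v

variable {V : Type v} [AddCommGroup V] [Module ℂ V]

lemma finrank_fil {ι : Type*} [Fintype ι] (b : Module.Basis ι ℂ V) (u : ι → ℝ) (r : ℝ) :
    Module.finrank ℂ (fil b u r) = (Finset.univ.filter fun i => r ≤ u i).card := by
  classical
  have h : fil b u r = Submodule.span ℂ (Set.range fun i : {i // r ≤ u i} => b i) := by
    apply le_antisymm
    · exact fil_le fun i hi => Submodule.subset_span ⟨⟨i, hi⟩, rfl⟩
    · rw [Submodule.span_le]
      rintro _ ⟨i, rfl⟩
      exact basis_mem_fil.2 i.2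
  have hli : LinearIndependent ℂ fun i : {i // r ≤ u i} => b i :=
    b.linearIndependent.comp _ Subtype.val_injective
  rw [h, finrank_span_eq_card hli, Fintype.card_subtype]

lemma card_eq_of_card_le_eq {n : ℕ} {u v : Fin n → ℝ}
    (h : ∀ r, (Finset.univ.filter fun i => r ≤ u i).card = (Finset.univ.filter fun i => r ≤ v i).card)
    (a : ℝ) : (Finset.univ.filter fun i => u i = a).card = (Finset.univ.filter fun i => v i = a).card := by
  classical
  obtain ⟨r, har, hr⟩ : ∃ r, a < r ∧ ∀ t ∈ Finset.univ.image u ∪ Finset.univ.image v, a < t → r ≤ t := by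
    set T := (Finset.univ.image u ∪ Finset.univ.image v).filter fun t => a < t
    rcases T.eq_empty_or_nonempty with hT | hT
    · refine ⟨a + 1, by linarith, fun t ht hat => ?_⟩
      have : t ∈ T := Finset.mem_filter.2 ⟨ht, hat⟩
      simp [hT] at this
    · obtain ⟨r, hr, hmin⟩ := Finset.exists_min_image T id hT
      exact ⟨r, (Finset.mem_filter.1 hr).2, fun t ht hat => hmin t (Finset.mem_filter.2 ⟨ht, hat⟩)⟩
  have split : ∀ w : Fin n → ℝ, (∀ i, a < w i → r ≤ w i) →
      (Finset.univ.filter fun i => a ≤ w i).card =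
      (Finset.univ.filter fun i => w i = a).card + (Finset.univ.filter fun i => r ≤ w i).card := by
    intro w hw
    rw [← Finset.card_union_of_disjoint]
    · congr 1
      ext i
      simp only [Finset.mem_filter, Finset.mem_univ, true_and, Finset.mem_union]
      constructor
      · intro hi
        rcases hi.eq_or_lt with h | h
        · exact Or.inl h.symm
        · exact Or.inr (hw i h)
      · rintro (h | h) <;> linarith
    · rw [Finset.disjoint_filter]
      intro i _ h1 h2
      linarith
  have h1 := split u fun i => hr (u i) (by simp)
  have h2 := split v fun i => hr (v i) (by simp)
  have h3 := h a
  have h4 := h r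
  omega

lemma sum_weights_eq {n : ℕ} {b b' : Module.Basis (Fin n) ℂ V} {u v : Fin n → ℝ}
    (h : ∀ r, fil b u r = fil b' v r) (g : ℝ → ℝ) : ∑ i, g (u i) = ∑ i, g (v i) := by
  classical
  have hcard := card_eq_of_card_le_eq (u := u) (v := v) fun r => by
    rw [← finrank_fil b, ← finrank_fil b', h]
  have key : Finset.univ.val.map u = Finset.univ.val.map v := by
    refine Multiset.ext.2 fun a => ?_
    rw [Multiset.count_map, Multiset.count_map]
    have := hcard a
    simpa [Finset.card, Finset.filter, eq_comm] using this
  have := congrArg (fun m => (m.map g).sum) key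
  simp only [Multiset.map_map] at this
  exact this

/-- A filtration compatible with a bilinear product. -/
def SupAdd (ν : V →ₗ[ℂ] V →ₗ[ℂ] V) (F : ℝ → Submodule ℂ V) : Prop :=
  ∀ r s, ∀ x ∈ F r, ∀ y ∈ F s, ν x y ∈ F (r + s)

lemma supAdd_fil_iff {ν : V →ₗ[ℂ] V →ₗ[ℂ] V} {ι : Type*} [Fintype ι] {b : Module.Basis ι ℂ V}
    {u : ι → ℝ} :
    SupAdd ν (fil b u) ↔ ∀ i j k, b.repr (ν (b i) (b j)) k ≠ 0 → u i + u j ≤ u k := by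
  constructor
  · intro h i j k hk
    exact h _ _ _ (basis_mem_fil.2 le_rfl) _ (basis_mem_fil.2 le_rfl) k hk
  · intro h r s x hx y hy
    have h1 : fil b u r ≤ (fil b u (r + s)).comap (ν.flip y) := by
      refine fil_le fun i hi => ?_
      have h2 : fil b u s ≤ (fil b u (r + s)).comap (ν (b i)) := by
        refine fil_le fun j hj => ?_
        intro k hk
        have := h i j k hk
        linarith
      exact h2 hy
    exact h1 hx

/-- The weighted basis `(b, u)` maximizes the slope `k ∑ w / |w|` among all weighted bases
compatible with `ν`. -/
structure IsOpt (ν : V →ₗ[ℂ] V →ₗ[ℂ] V) (k : ℝ) {n : ℕ} (b : Module.Basis (Fin n) ℂ V)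
    (u : Fin n → ℝ) : Prop where
  compat : SupAdd ν (fil b u)
  sum_sq : ∑ i, u i ^ 2 = k * ∑ i, u i
  slope : ∀ (b' : Module.Basis (Fin n) ℂ V) (w : Fin n → ℝ), SupAdd ν (fil b' w) →
    k * ∑ i, w i ≤ √(∑ i, u i ^ 2) * √(∑ i, w i ^ 2)

lemma exists_cone_projection {n : ℕ} (k : ℝ) (S : Set (Fin n × Fin n × Fin n)) :
    ∃ u : Fin n → ℝ, (∀ t ∈ S, u t.1 + u t.2.1 ≤ u t.2.2) ∧ ∑ i, u i ^ 2 = k * ∑ i, u i ∧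
      ∀ w : Fin n → ℝ, (∀ t ∈ S, w t.1 + w t.2.1 ≤ w t.2.2) → k * ∑ i, w i ≤ ∑ i, u i * w i := by
  set K : Set (EuclideanSpace ℝ (Fin n)) := {w | ∀ t ∈ S, w t.1 + w t.2.1 ≤ w t.2.2} with hK
  have hconv : Convex ℝ K := by
    intro x hx y hy a b ha hb _ t ht
    have h1 := mul_le_mul_of_nonneg_left (hx t ht) ha
    have h2 := mul_le_mul_of_nonneg_left (hy t ht) hb
    simp only [PiLp.add_apply, PiLp.smul_apply, smul_eq_mul]
    linarith
  have hclosed : IsClosed K := by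
    have : K = ⋂ t ∈ S, {w | w t.1 + w t.2.1 ≤ w t.2.2} := by ext; simp [hK]
    rw [this]
    refine isClosed_biInter fun t _ => isClosed_le ?_ ?_ <;> fun_prop
  have h0 : (0 : EuclideanSpace ℝ (Fin n)) ∈ K := fun t _ => by simp
  set p : EuclideanSpace ℝ (Fin n) := WithLp.toLp 2 fun _ => k with hp
  obtain ⟨u, hu, hmin⟩ := exists_norm_eq_iInf_of_complete_convex ⟨0, h0⟩ hclosed.isComplete hconv p
  rw [norm_eq_iInf_iff_real_inner_le_zero hconv hu] at hmin
  have hin : ∀ w, inner ℝ (p - u) w = k * ∑ i, w i - ∑ i, u i * w i := by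
    intro w
    rw [PiLp.inner_apply, Finset.mul_sum, ← Finset.sum_sub_distrib]
    refine Finset.sum_congr rfl fun i _ => ?_
    simp [hp]
    ring
  have h1 : inner ℝ (p - u) u = 0 := by
    have e1 := hmin 0 h0
    have e2 := hmin ((2 : ℝ) • u) fun t ht => by
      have := hu t ht
      simp only [PiLp.smul_apply, smul_eq_mul]
      linarith
    rw [zero_sub, inner_neg_right] at e1
    rw [two_smul, add_sub_cancel_right] at e2
    linarith
  refine ⟨u, hu, ?_, fun w hw => ?_⟩
  · rw [hin] at h1
    simp only [pow_two]
    linarith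
  · have := hmin (WithLp.toLp 2 w) hw
    rw [inner_sub_right, h1, hin] at this
    simpa using this

lemma exists_isOpt (ν : V →ₗ[ℂ] V →ₗ[ℂ] V) (k : ℝ) {n : ℕ} (b₀ : Module.Basis (Fin n) ℂ V) :
    ∃ (b : Module.Basis (Fin n) ℂ V) (u : Fin n → ℝ), IsOpt ν k b u := by
  choose u hu1 hu2 hu3 using exists_cone_projection (n := n) k
  let supp : Module.Basis (Fin n) ℂ V → Set (Fin n × Fin n × Fin n) := fun b =>
    {t | b.repr (ν (b t.1) (b t.2.1)) t.2.2 ≠ 0}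
  have hcomp : ∀ b w, SupAdd ν (fil b w) ↔ ∀ t ∈ supp b, w t.1 + w t.2.1 ≤ w t.2.2 := by
    intro b w
    rw [supAdd_fil_iff]
    exact ⟨fun h t ht => h _ _ _ ht, fun h i j l hl => h (i, j, l) hl⟩
  have hfin : (Set.range supp).Finite := Set.toFinite _
  obtain ⟨_, ⟨b, rfl⟩, hmax⟩ := Set.exists_max_image (Set.range supp)
    (fun S => ∑ i, u S i ^ 2) hfin ⟨_, b₀, rfl⟩
  refine ⟨b, u (supp b), (hcomp _ _).2 (hu1 _), hu2 _, fun b' w hw => ?_⟩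
  refine (hu3 (supp b') w ((hcomp _ _).1 hw)).trans ?_
  refine (Real.sum_mul_le_sqrt_mul_sqrt _ _ _).trans ?_
  gcongr ?_ * _
  exact Real.sqrt_le_sqrt (hmax _ ⟨b', rfl⟩)

variable {ν : V →ₗ[ℂ] V →ₗ[ℂ] V} {k : ℝ} {n : ℕ} {b b' : Module.Basis (Fin n) ℂ V}
  {u u' : Fin n → ℝ}

lemma IsOpt.congr (h : IsOpt ν k b u) (hF : ∀ r, fil b u r = fil b' u' r) : IsOpt ν k b' u' := by
  have h1 := sum_weights_eq hF id
  have h2 := sum_weights_eq hF (fun x => x ^ 2)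
  simp only [id] at h1 h2
  have h3 : fil b u = fil b' u' := funext hF
  exact ⟨h3 ▸ h.compat, by rw [← h1, ← h2, h.sum_sq], fun β w hw => by
    rw [← h2]; exact h.slope β w hw⟩

lemma IsOpt.sum_sq_le (h : IsOpt ν k b u) (h' : IsOpt ν k b' u') :
    ∑ i, u i ^ 2 ≤ ∑ i, u' i ^ 2 := by
  have h1 := h'.slope b u h.compat
  rw [← h.sum_sq] at h1
  have hN : 0 ≤ ∑ i, u i ^ 2 := Finset.sum_nonneg fun i _ => sq_nonneg _
  have hN' : 0 ≤ ∑ i, u' i ^ 2 := Finset.sum_nonneg fun i _ => sq_nonneg _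
  rcases hN.eq_or_lt with h0 | h0
  · rw [← h0]; exact hN'
  · have h2 : √(∑ i, u i ^ 2) ≤ √(∑ i, u' i ^ 2) := by
      have hpos := Real.sqrt_pos.2 h0
      refine le_of_mul_le_mul_right ?_ hpos
      rw [Real.mul_self_sqrt hN]
      exact h1
    exact (Real.sqrt_le_sqrt_iff hN').1 h2

lemma SupAdd.weights_add {w w' : Fin n → ℝ} (h : SupAdd ν (fil b w)) (h' : SupAdd ν (fil b w')) :
    SupAdd ν (fil b (fun i => w i + w' i)) := by
  rw [supAdd_fil_iff] at *
  intro i j l hl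
  have h1 := h i j l hl
  have h2 := h' i j l hl
  linarith

lemma SupAdd.weights_smul {w : Fin n → ℝ} (h : SupAdd ν (fil b w)) {t : ℝ} (ht : 0 ≤ t) :
    SupAdd ν (fil b (fun i => t * w i)) := by
  rw [supAdd_fil_iff] at *
  intro i j l hl
  have h1 := mul_le_mul_of_nonneg_left (h i j l hl) ht
  linarith

lemma IsOpt.weights_eq (h : IsOpt ν k b u) (h' : IsOpt ν k b u') : u = u' := by
  have hN : ∑ i, u i ^ 2 = ∑ i, u' i ^ 2 := le_antisymm (h.sum_sq_le h') (h'.sum_sq_le h)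
  have hs := h.slope b _ (h.compat.weights_add h'.compat)
  have hN0 : 0 ≤ ∑ i, u i ^ 2 := Finset.sum_nonneg fun i _ => sq_nonneg _
  have hW0 : 0 ≤ ∑ i, (u i + u' i) ^ 2 := Finset.sum_nonneg fun i _ => sq_nonneg _
  rw [Finset.sum_add_distrib, mul_add, ← h.sum_sq, ← h'.sum_sq, ← hN] at hs
  have hpar : ∑ i, (u i - u' i) ^ 2 = 4 * ∑ i, u i ^ 2 - ∑ i, (u i + u' i) ^ 2 := by
    have e : ∑ i, (u i - u' i) ^ 2 + ∑ i, (u i + u' i) ^ 2 =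
        2 * ∑ i, u i ^ 2 + 2 * ∑ i, u' i ^ 2 := by
      rw [← Finset.sum_add_distrib, Finset.mul_sum, Finset.mul_sum, ← Finset.sum_add_distrib]
      exact Finset.sum_congr rfl fun i _ => by ring
    linarith
  have hle : 4 * ∑ i, u i ^ 2 ≤ ∑ i, (u i + u' i) ^ 2 := by
    rcases hN0.eq_or_lt with h0 | h0
    · rw [← h0]; simpa using hW0
    · have hpos := Real.sqrt_pos.2 h0
      have h2 : 2 * √(∑ i, u i ^ 2) ≤ √(∑ i, (u i + u' i) ^ 2) := by
        refine le_of_mul_le_mul_left ?_ hpos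
        have := Real.mul_self_sqrt hN0
        nlinarith
      have h3 := mul_self_le_mul_self (by positivity) h2
      rw [Real.mul_self_sqrt hW0] at h3
      have := Real.mul_self_sqrt hN0
      nlinarith
  have hz : ∑ i, (u i - u' i) ^ 2 = 0 :=
    le_antisymm (by linarith) (Finset.sum_nonneg fun i _ => sq_nonneg _)
  funext i
  have := (Finset.sum_eq_zero_iff_of_nonneg fun i _ => sq_nonneg (u i - u' i)).1 hz i
    (Finset.mem_univ i)
  have := pow_eq_zero_iff (two_ne_zero) |>.1 this
  linarith

lemma IsOpt.fil_eq (h : IsOpt ν k b u) (h' : IsOpt ν k b' u') (r : ℝ) :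
    fil b u r = fil b' u' r := by
  have : FiniteDimensional ℂ V := b.finiteDimensional_of_finite
  obtain ⟨β, -, v, v', -, hv, hv'⟩ := exists_adapted_eigenbasis n V
    (by rw [Module.finrank_eq_card_basis b]; simp) 0 Module.End.isSemisimple_zero _ _
    (isFil_fil b u) (isFil_fil b' u') (fun r x _ => by simp) (fun r x _ => by simp)
  have := (h.congr hv).weights_eq (h'.congr hv')
  rw [hv, hv', this]

lemma IsOpt.mem_of_automorphism (h : IsOpt ν k b u) (φ : V ≃ₗ[ℂ] V)
    (hφ : ∀ x y, φ (ν x y) = ν (φ x) (φ y)) {r : ℝ} {x : V} (hx : x ∈ fil b u r) :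
    φ x ∈ fil b u r := by
  have hrepr : ∀ y, (b.map φ).repr y = b.repr (φ.symm y) := fun y => rfl
  have h' : IsOpt ν k (b.map φ) u := by
    refine ⟨?_, h.sum_sq, h.slope⟩
    have := h.compat
    rw [supAdd_fil_iff] at this ⊢
    intro i j l hl
    apply this i j l
    simpa [hrepr, ← hφ] using hl
  rw [h.fil_eq h' r, mem_fil, hrepr, LinearEquiv.symm_apply_apply]
  exact hx

lemma IsOpt.inner_ge (h : IsOpt ν k b u) {w : Fin n → ℝ} (hw : SupAdd ν (fil b w)) :
    k * ∑ i, w i ≤ ∑ i, u i * w i := by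
  have hN0 : 0 ≤ ∑ i, u i ^ 2 := Finset.sum_nonneg fun i _ => sq_nonneg _
  set N := ∑ i, u i ^ 2 with hN
  set A := k * ∑ i, w i with hA
  set B := ∑ i, u i * w i with hB
  set C := ∑ i, w i ^ 2 with hC
  have hC0 : 0 ≤ C := Finset.sum_nonneg fun i _ => sq_nonneg _
  have key : ∀ t : ℝ, 0 ≤ t → N + t * A ≤ √N * √(N + 2 * t * B + t ^ 2 * C) := by
    intro t ht
    have h1 := h.slope b _ (h.compat.weights_add (hw.weights_smul ht))
    have e1 : k * ∑ i, (u i + t * w i) = N + t * A := by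
      rw [Finset.sum_add_distrib, mul_add, ← h.sum_sq, ← Finset.mul_sum]; ring
    have e2 : ∑ i, (u i + t * w i) ^ 2 = N + 2 * t * B + t ^ 2 * C := by
      rw [hN, hB, hC, Finset.mul_sum, Finset.mul_sum, ← Finset.sum_add_distrib,
        ← Finset.sum_add_distrib]
      exact Finset.sum_congr rfl fun i _ => by ring
    rwa [e1, e2] at h1
  rcases hN0.eq_or_lt with h0 | h0
  · have hu : ∀ i, u i = 0 := fun i => by
      have := (Finset.sum_eq_zero_iff_of_nonneg fun i _ => sq_nonneg (u i)).1 h0.symm i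
        (Finset.mem_univ i)
      exact pow_eq_zero_iff (two_ne_zero) |>.1 this
    have h1 := key 1 zero_le_one
    rw [← h0] at h1
    simp only [hB, hu]
    simpa using h1
  · by_contra hcon
    push Not at hcon
    obtain ⟨t, ht0, ht1, ht2⟩ : ∃ t : ℝ, 0 < t ∧ 0 ≤ N + t * A ∧ t * (N * C) < 2 * N * (A - B) := by
      have hpos : 0 < 2 * N * (A - B) := by have := sub_pos.2 hcon; positivity
      refine ⟨min (N / (|A| + 1)) (2 * N * (A - B) / (N * C + 1)), ?_, ?_, ?_⟩
      · have : 0 < |A| + 1 := by positivity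
        have : 0 < N * C + 1 := by positivity
        exact lt_min (by positivity) (by positivity)
      · set t := min (N / (|A| + 1)) (2 * N * (A - B) / (N * C + 1))
        have h1 : t ≤ N / (|A| + 1) := min_le_left _ _
        rw [le_div_iff₀ (by positivity)] at h1
        have h2 : 0 ≤ t := le_min (by positivity) (by positivity)
        have h3 := neg_abs_le A
        nlinarith
      · set t := min (N / (|A| + 1)) (2 * N * (A - B) / (N * C + 1))
        have h1 : t ≤ 2 * N * (A - B) / (N * C + 1) := min_le_right _ _
        rw [le_div_iff₀ (by positivity)] at h1
        have h2 : 0 < t := by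
          have : 0 < |A| + 1 := by positivity
          have : 0 < N * C + 1 := by positivity
          exact lt_min (by positivity) (by positivity)
        nlinarith
    have h1 := key t ht0.le
    rw [← Real.sqrt_mul hN0] at h1
    have h3 : 0 ≤ N * (N + 2 * t * B + t ^ 2 * C) := by
      have e2 : ∑ i, (u i + t * w i) ^ 2 = N + 2 * t * B + t ^ 2 * C := by
        rw [hN, hB, hC, Finset.mul_sum, Finset.mul_sum, ← Finset.sum_add_distrib,
          ← Finset.sum_add_distrib]
        exact Finset.sum_congr rfl fun i _ => by ring
      rw [← e2]
      exact mul_nonneg hN0 (Finset.sum_nonneg fun i _ => sq_nonneg _)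
    have h2 := mul_self_le_mul_self ht1 h1
    rw [Real.mul_self_sqrt h3] at h2
    have h4 : t * (2 * N * (A - B)) ≤ t * (t * (N * C)) := by nlinarith [sq_nonneg (t * A)]
    have h5 := le_of_mul_le_mul_left h4 ht0
    linarith

lemma IsOpt.nonneg (h : IsOpt ν k b u) (hk : 0 < k)
    (hl : ∀ i j l, b.repr (ν (b i) (b j)) l ≠ 0 → u j ≤ u l)
    (hr : ∀ i j l, b.repr (ν (b i) (b j)) l ≠ 0 → u i ≤ u l) (i : Fin n) : 0 ≤ u i := by
  have hc : SupAdd ν (fil b fun i => max (u i) 0) := by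
    have hcomp := supAdd_fil_iff.1 h.compat
    rw [supAdd_fil_iff]
    intro i j l hijl
    have h1 := hl i j l hijl
    have h2 := hr i j l hijl
    have h3 := hcomp i j l hijl
    rcases le_total (u i) 0 with hi | hi <;> rcases le_total (u j) 0 with hj | hj <;>
      simp [hi, hj] <;> grind
  have h1 := h.inner_ge hc
  have h2 := h.sum_sq
  have h3 : ∑ i, (k * (max (u i) 0 - u i) + (max (u i) 0 - u i) ^ 2) ≤ 0 := by
    have e : ∑ i, (k * (max (u i) 0 - u i) + (max (u i) 0 - u i) ^ 2) =
        k * ∑ i, max (u i) 0 - ∑ i, u i * max (u i) 0 + (∑ i, u i ^ 2 - k * ∑ i, u i) := by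
      rw [Finset.mul_sum, Finset.mul_sum, ← Finset.sum_sub_distrib, ← Finset.sum_sub_distrib,
        ← Finset.sum_add_distrib]
      refine Finset.sum_congr rfl fun i _ => ?_
      rcases le_total (u i) 0 with hi | hi <;> simp [hi] <;> ring
    linarith
  have h4 : ∀ i ∈ Finset.univ, 0 ≤ k * (max (u i) 0 - u i) + (max (u i) 0 - u i) ^ 2 := by
    intro i _
    have : 0 ≤ max (u i) 0 - u i := sub_nonneg.2 (le_max_left _ _)
    positivity
  have h5 := (Finset.sum_eq_zero_iff_of_nonneg h4).1 (le_antisymm h3 (Finset.sum_nonneg h4)) i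
    (Finset.mem_univ i)
  by_contra hneg
  push Not at hneg
  rw [max_eq_right hneg.le] at h5
  nlinarith

end Weights

section Derivations

universe v

/-- Derivations of a complex algebra given by a bilinear product. -/
def IsDerivC {V : Type v} [AddCommGroup V] [Module ℂ V] (ν : V →ₗ[ℂ] V →ₗ[ℂ] V)
    (X : V →ₗ[ℂ] V) : Prop :=
  ∀ x y, X (ν x y) = ν (X x) y + ν x (X y)

section Flow

variable {W : Type v} [NormedAddCommGroup W] [NormedSpace ℂ W] [FiniteDimensional ℂ W]

lemma hasDerivAt_exp_apply (A : W →L[ℂ] W) (x : W) (t : ℂ) :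
    HasDerivAt (fun t : ℂ => NormedSpace.exp (t • A) x) (A (NormedSpace.exp (t • A) x)) t := by
  have h := (hasDerivAt_exp_smul_const' (𝕂 := ℂ) A t).clm_apply (hasDerivAt_const t x)
  simpa using h

lemma hasDerivAt_exp_neg_apply (A : W →L[ℂ] W) {g : ℂ → W} {g' : W} {t : ℂ}
    (hg : HasDerivAt g g' t) :
    HasDerivAt (fun t : ℂ => NormedSpace.exp ((-t) • A) (g t))
      (NormedSpace.exp ((-t) • A) (g' - A (g t))) t := by
  have h1 : HasDerivAt (fun t : ℂ => NormedSpace.exp ((-t) • A))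
      (-(NormedSpace.exp ((-t) • A) * A)) t := by
    have := (hasDerivAt_exp_smul_const (𝕂 := ℂ) A (-t)).scomp t (hasDerivAt_neg t)
    simpa [Function.comp_def] using this
  have h := h1.clm_apply hg
  convert h using 1
  simp [sub_eq_neg_add]

lemma exp_neg_exp_apply (A : W →L[ℂ] W) (x : W) (t : ℂ) :
    NormedSpace.exp ((-t) • A) (NormedSpace.exp (t • A) x) = x := by
  have h : ∀ t : ℂ, HasDerivAt
      (fun t : ℂ => NormedSpace.exp ((-t) • A) (NormedSpace.exp (t • A) x)) 0 t := by
    intro t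
    have := hasDerivAt_exp_neg_apply A (hasDerivAt_exp_apply A x t)
    simpa using this
  have := is_const_of_deriv_eq_zero (fun t => (h t).differentiableAt) (fun t => (h t).deriv) t 0
  simpa using this

lemma exp_derivation_apply {ν : W →ₗ[ℂ] W →ₗ[ℂ] W} (A : W →L[ℂ] W) (hA : IsDerivC ν A)
    (x y : W) (t : ℂ) :
    NormedSpace.exp (t • A) (ν x y) = ν (NormedSpace.exp (t • A) x) (NormedSpace.exp (t • A) y) := by
  have hb : ∀ t : ℂ, HasDerivAt
      (fun t : ℂ => ν (NormedSpace.exp (t • A) x) (NormedSpace.exp (t • A) y))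
      (A (ν (NormedSpace.exp (t • A) x) (NormedSpace.exp (t • A) y))) t := by
    intro t
    have h1 := ((LinearMap.toContinuousBilinearMap ν).hasFDerivAt.comp_hasDerivAt t
      (hasDerivAt_exp_apply A x t)).clm_apply (hasDerivAt_exp_apply A y t)
    exact h1.congr_deriv (hA _ _).symm
  have h : ∀ t : ℂ, HasDerivAt (fun t : ℂ => NormedSpace.exp ((-t) • A)
      (ν (NormedSpace.exp (t • A) x) (NormedSpace.exp (t • A) y))) 0 t := by
    intro t
    have := hasDerivAt_exp_neg_apply A (hb t)
    simpa using this
  have h0 := is_const_of_deriv_eq_zero (fun t => (h t).differentiableAt) (fun t => (h t).deriv) t 0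
  have h1 : NormedSpace.exp ((-t) • A)
      (ν (NormedSpace.exp (t • A) x) (NormedSpace.exp (t • A) y)) = ν x y := by
    simpa using h0
  rw [← h1]
  simpa using exp_neg_exp_apply A (ν (NormedSpace.exp (t • A) x) (NormedSpace.exp (t • A) y)) (-t)

theorem IsOpt.mem_of_derivation {ν : W →ₗ[ℂ] W →ₗ[ℂ] W} {k : ℝ} {n : ℕ}
    {b : Module.Basis (Fin n) ℂ W} {u : Fin n → ℝ} (h : IsOpt ν k b u) {X : W →ₗ[ℂ] W}
    (hX : IsDerivC ν X) {r : ℝ} {x : W} (hx : x ∈ fil b u r) : X x ∈ fil b u r := by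
  set A : W →L[ℂ] W := LinearMap.toContinuousLinearMap X with hA
  have hAX : ∀ x, A x = X x := fun x => rfl
  by_contra hcon
  obtain ⟨f, hf, hfF⟩ := Submodule.exists_le_ker_of_notMem hcon
  have hflow : ∀ t : ℂ, NormedSpace.exp (t • A) x ∈ fil b u r := by
    intro t
    let φ : W ≃ₗ[ℂ] W := LinearEquiv.ofLinearMap (NormedSpace.exp (t • A) : W →L[ℂ] W)
      (NormedSpace.exp ((-t) • A) : W →L[ℂ] W)
      (LinearMap.ext fun y => by simpa using exp_neg_exp_apply A y (-t))
      (LinearMap.ext fun y => by simpa using exp_neg_exp_apply A y t)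
    exact h.mem_of_automorphism φ (fun x y => exp_derivation_apply A hX x y t) hx
  have hd := (LinearMap.toContinuousLinearMap f).hasFDerivAt.comp_hasDerivAt (0 : ℂ)
    (hasDerivAt_exp_apply A x 0)
  have hz : (LinearMap.toContinuousLinearMap f) ∘ (fun t : ℂ => NormedSpace.exp (t • A) x) =
      fun _ => 0 := by
    funext t
    exact hfF (hflow t)
  rw [hz] at hd
  have := hd.unique (hasDerivAt_const (0 : ℂ) (0 : ℂ))
  simp [hAX] at this
  exact hf this

end Flow

section JordanChevalley

variable {V : Type v} [AddCommGroup V] [Module ℂ V]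

lemma sum_weighted_eq {n : ℕ} {u u' : Fin n → ℝ} {a a' : Fin n → ℂ}
    (h : ∀ r, ∑ i with r ≤ u i, a i = ∑ i with r ≤ u' i, a' i) :
    ∑ i, (u i : ℂ) * a i = ∑ i, (u' i : ℂ) * a' i := by
  classical
  set T := Finset.univ.image u ∪ Finset.univ.image u' with hT
  have hlev : ∀ r, ∑ i with u i = r, a i = ∑ i with u' i = r, a' i := by
    intro a₀
    obtain ⟨r, har, hr⟩ : ∃ r, a₀ < r ∧ ∀ t ∈ T, a₀ < t → r ≤ t := by
      rcases (T.filter fun t => a₀ < t).eq_empty_or_nonempty with hT | hT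
      · refine ⟨a₀ + 1, by linarith, fun t ht hat => ?_⟩
        have : t ∈ T.filter fun t => a₀ < t := Finset.mem_filter.2 ⟨ht, hat⟩
        simp [hT] at this
      · obtain ⟨r, hr, hmin⟩ := Finset.exists_min_image _ id hT
        exact ⟨r, (Finset.mem_filter.1 hr).2,
          fun t ht hat => hmin t (Finset.mem_filter.2 ⟨ht, hat⟩)⟩
    have split : ∀ (w : Fin n → ℝ) (f : Fin n → ℂ), (∀ i, a₀ < w i → r ≤ w i) →
        ∑ i with a₀ ≤ w i, f i = ∑ i with w i = a₀, f i + ∑ i with r ≤ w i, f i := by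
      intro w f hw
      rw [← Finset.sum_union]
      · congr 1
        ext i
        simp only [Finset.mem_filter, Finset.mem_univ, true_and, Finset.mem_union]
        constructor
        · intro hi
          rcases hi.eq_or_lt with h | h
          · exact Or.inl h.symm
          · exact Or.inr (hw i h)
        · rintro (h | h) <;> linarith
      · rw [Finset.disjoint_filter]
        intro i _ h1 h2
        linarith
    have h1 := split u a fun i => hr (u i) (by simp [hT])
    have h2 := split u' a' fun i => hr (u' i) (by simp [hT])
    rw [h a₀, h r, h2] at h1
    exact (add_right_cancel h1).symm
  have hsum : ∀ (w : Fin n → ℝ) (f : Fin n → ℂ), (∀ i, w i ∈ T) →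
      ∑ i, (w i : ℂ) * f i = ∑ t ∈ T, (t : ℂ) * ∑ i with w i = t, f i := by
    intro w f hw
    rw [← Finset.sum_fiberwise_of_maps_to (s := Finset.univ) (t := T) (g := w) (fun i _ => hw i)]
    refine Finset.sum_congr rfl fun t _ => ?_
    rw [Finset.mul_sum]
    exact Finset.sum_congr rfl fun i hi => by rw [(Finset.mem_filter.1 hi).2]
  rw [hsum u a (fun i => by simp [hT]), hsum u' a' (fun i => by simp [hT])]
  exact Finset.sum_congr rfl fun t _ => by rw [hlev]

/-- The projection onto a step of the filtration of a weighted basis. -/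
def filProj {n : ℕ} (b : Module.Basis (Fin n) ℂ V) (u : Fin n → ℝ) (r : ℝ) : V →ₗ[ℂ] V :=
  b.constr ℂ fun i => if r ≤ u i then b i else 0

lemma filProj_basis {n : ℕ} (b : Module.Basis (Fin n) ℂ V) (u : Fin n → ℝ) (r : ℝ) (i : Fin n) :
    filProj b u r (b i) = if r ≤ u i then b i else 0 := by
  rw [filProj, Module.Basis.constr_basis]

lemma filProj_mem {n : ℕ} (b : Module.Basis (Fin n) ℂ V) (u : Fin n → ℝ) (r : ℝ) (x : V) :
    filProj b u r x ∈ fil b u r := by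
  rw [← b.sum_repr x, map_sum]
  refine Submodule.sum_mem _ fun i _ => ?_
  rw [map_smul, filProj_basis]
  split_ifs with h
  · exact Submodule.smul_mem _ _ (basis_mem_fil.2 h)
  · simp

lemma filProj_of_mem {n : ℕ} {b : Module.Basis (Fin n) ℂ V} {u : Fin n → ℝ} {r : ℝ} {x : V}
    (hx : x ∈ fil b u r) : filProj b u r x = x := by
  conv_rhs => rw [← b.sum_repr x]
  conv_lhs => rw [← b.sum_repr x, map_sum]
  refine Finset.sum_congr rfl fun i _ => ?_
  rw [map_smul, filProj_basis]
  split_ifs with h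
  · rfl
  · have : b.repr x i = 0 := by
      by_contra h0
      exact h (hx i h0)
    simp [this]

lemma trace_comp_filProj {n : ℕ} (b : Module.Basis (Fin n) ℂ V) (u : Fin n → ℝ) (r : ℝ)
    (X : V →ₗ[ℂ] V) :
    LinearMap.trace ℂ V (X ∘ₗ filProj b u r) = ∑ i with r ≤ u i, b.repr (X (b i)) i := by
  rw [LinearMap.trace_eq_matrix_trace ℂ b, Matrix.trace, Finset.sum_filter]
  refine Finset.sum_congr rfl fun i _ => ?_
  rw [Matrix.diag_apply, LinearMap.toMatrix_apply, LinearMap.comp_apply, filProj_basis]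
  split_ifs <;> simp

lemma sum_weighted_diag_eq {n : ℕ} {b b' : Module.Basis (Fin n) ℂ V} {u u' : Fin n → ℝ}
    (hF : ∀ r, fil b u r = fil b' u' r) {X : V →ₗ[ℂ] V}
    (hX : ∀ r, ∀ x ∈ fil b u r, X x ∈ fil b u r) :
    ∑ i, (u i : ℂ) * b.repr (X (b i)) i = ∑ i, (u' i : ℂ) * b'.repr (X (b' i)) i := by
  have := Module.Finite.of_basis b
  refine sum_weighted_eq fun r => ?_
  rw [← trace_comp_filProj, ← trace_comp_filProj]
  have h1 : X ∘ₗ filProj b u r = filProj b' u' r ∘ₗ (X ∘ₗ filProj b u r) := by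
    ext x
    have hm : X (filProj b u r x) ∈ fil b' u' r := by
      rw [← hF r]
      exact hX r _ (filProj_mem b u r x)
    rw [LinearMap.comp_apply, LinearMap.comp_apply, LinearMap.comp_apply, filProj_of_mem hm]
  have h2 : filProj b u r ∘ₗ filProj b' u' r = filProj b' u' r := by
    ext x
    have hm : filProj b' u' r x ∈ fil b u r := by
      rw [hF r]
      exact filProj_mem b' u' r x
    rw [LinearMap.comp_apply, filProj_of_mem hm]
  rw [h1, LinearMap.trace_comp_comm', LinearMap.comp_assoc, h2]

lemma sum_weighted_diag_nilpotent {n : ℕ} {b : Module.Basis (Fin n) ℂ V} {u : Fin n → ℝ}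
    {N : Module.End ℂ V} (hN : IsNilpotent N)
    (hNF : ∀ r, ∀ x ∈ fil b u r, N x ∈ fil b u r) :
    ∑ i, (u i : ℂ) * b.repr (N (b i)) i = 0 := by
  have : ∑ i, (u i : ℂ) * b.repr (N (b i)) i = ∑ i, (u i : ℂ) * (fun _ => (0 : ℂ)) i := by
    refine sum_weighted_eq fun r => ?_
    rw [← trace_comp_filProj]
    obtain ⟨P, hP⟩ : ∃ P : Module.End ℂ V, P = filProj b u r := ⟨_, rfl⟩
    rw [← hP]
    have hmem : ∀ p x, (N ^ p) (P x) ∈ fil b u r := by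
      intro p x
      induction p with
      | zero => exact hP ▸ filProj_mem b u r x
      | succ p ihp =>
        rw [pow_succ']
        exact hNF r _ ihp
    have hpow : ∀ m x, ((N * P) ^ (m + 1)) x = (N ^ (m + 1)) (P x) := by
      intro m x
      induction m with
      | zero => simp
      | succ m ih =>
        rw [pow_succ', Module.End.mul_apply, ih, Module.End.mul_apply, pow_succ' N (m + 1),
          Module.End.mul_apply]
        congr 1
        rw [hP, filProj_of_mem (hP ▸ hmem _ x)]
    obtain ⟨m, hm⟩ := hN
    have hnil : IsNilpotent (N * P) :=
      ⟨m + 1, LinearMap.ext fun x => by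
        rw [hpow, pow_succ', hm, mul_zero, LinearMap.zero_apply, LinearMap.zero_apply]⟩
    have h0 := LinearMap.isNilpotent_trace_of_isNilpotent hnil
    rw [isNilpotent_iff_eq_zero] at h0
    rw [Finset.sum_const_zero]
    exact h0
  rw [this]
  exact Finset.sum_eq_zero fun i _ => mul_zero _

lemma pow_sub_apply_eq_zero {A N : Module.End ℂ V} (hAN : Commute A N) (d : ℕ) :
    ∀ (p q : ℕ) (z : V), p + q ≤ d → (A ^ p) z = 0 → (N ^ q) z = 0 → ((A - N) ^ d) z = 0 := by
  induction d with
  | zero =>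
    intro p q z h hA hN
    obtain rfl : p = 0 := by omega
    simpa using hA
  | succ d ih =>
    intro p q z h hA hN
    rcases p with _ | p
    · have : z = 0 := by simpa using hA
      simp [this]
    rcases q with _ | q
    · have : z = 0 := by simpa using hN
      simp [this]
    rw [pow_succ, Module.End.mul_apply, LinearMap.sub_apply, map_sub]
    have h1 : ((A - N) ^ d) (A z) = 0 := by
      refine ih p (q + 1) _ (by omega) ?_ ?_
      · rwa [pow_succ] at hA
      · rw [← Module.End.mul_apply, ← (hAN.pow_right (q + 1)).eq, Module.End.mul_apply, hN, map_zero]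
    have h2 : ((A - N) ^ d) (N z) = 0 := by
      refine ih (p + 1) q _ (by omega) ?_ ?_
      · rw [← Module.End.mul_apply, (hAN.pow_left (p + 1)).eq, Module.End.mul_apply, hA, map_zero]
      · rwa [pow_succ] at hN
    rw [h1, h2, sub_zero]

lemma pow_sub_apply_product_eq_zero {ν : V →ₗ[ℂ] V →ₗ[ℂ] V} {ψ N S : Module.End ℂ V}
    (hψ : IsDerivC ν ψ) (hsum : ψ = N + S) (hNS : Commute N S) {l m : ℂ} (d : ℕ) :
    ∀ (p q : ℕ) (x y : V), p + q ≤ d → S x = l • x → S y = m • y → (N ^ p) x = 0 → (N ^ q) y = 0 →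
      ((ψ - (l + m) • 1) ^ d) (ν x y) = 0 := by
  induction d with
  | zero =>
    intro p q x y h _ _ hx _
    obtain rfl : p = 0 := by omega
    have : x = 0 := by simpa using hx
    simp [this]
  | succ d ih =>
    intro p q x y h hSx hSy hx hy
    rcases p with _ | p
    · have : x = 0 := by simpa using hx
      simp [this]
    rcases q with _ | q
    · have : y = 0 := by simpa using hy
      simp [this]
    have hstep : (ψ - (l + m) • 1) (ν x y) = ν (N x) y + ν x (N y) := by
      rw [LinearMap.sub_apply, hψ x y, hsum]
      simp only [LinearMap.add_apply, hSx, hSy, map_add, map_smul, LinearMap.smul_apply,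
        Module.End.one_apply, add_smul]
      abel
    have hcomm : ∀ z (a : ℂ), S z = a • z → S (N z) = a • N z := by
      intro z a hz
      rw [← Module.End.mul_apply, ← hNS.eq, Module.End.mul_apply, hz, map_smul]
    rw [pow_succ, Module.End.mul_apply, hstep, map_add,
      ih p (q + 1) (N x) y (by omega) (hcomm x l hSx) hSy (by rwa [pow_succ] at hx) hy,
      ih (p + 1) q x (N y) (by omega) hSx (hcomm y m hSy) hx (by rwa [pow_succ] at hy), add_zero]

lemma semisimple_part_product {ν : V →ₗ[ℂ] V →ₗ[ℂ] V} {ψ N S : Module.End ℂ V}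
    (hψ : IsDerivC ν ψ) (hsum : ψ = N + S) (hNS : Commute N S) (hN : IsNilpotent N)
    (hS : S.IsSemisimple) {l m : ℂ} {x y : V} (hx : S x = l • x) (hy : S y = m • y) :
    S (ν x y) = (l + m) • ν x y := by
  obtain ⟨p, hp⟩ := hN
  have h1 := pow_sub_apply_product_eq_zero hψ hsum hNS (p + p) p p x y le_rfl hx hy
    (by simp [hp]) (by simp [hp])
  have hcomm : Commute (ψ - (l + m) • (1 : Module.End ℂ V)) N := by
    rw [hsum]
    exact ((Commute.refl N).add_left hNS.symm).sub_left ((Commute.one_left N).smul_left _)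
  have h2 := pow_sub_apply_eq_zero hcomm (p + p + p) (p + p) p _ le_rfl h1
    (by rw [hp]; simp)
  have h3 : ψ - (l + m) • (1 : Module.End ℂ V) - N = S - (l + m) • 1 := by rw [hsum]; abel
  rw [h3] at h2
  have h4 : ν x y ∈ S.maxGenEigenspace (l + m) := (Module.End.mem_maxGenEigenspace _ _ _).2 ⟨_, h2⟩
  rw [hS.isFinitelySemisimple.maxGenEigenspace_eq_eigenspace] at h4
  exact Module.End.mem_eigenspace_iff.1 h4

lemma mem_of_mem_adjoin {ψ T : Module.End ℂ V} (hT : T ∈ Algebra.adjoin ℂ {ψ})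
    {p : Submodule ℂ V} (hp : ∀ x ∈ p, ψ x ∈ p) : ∀ x ∈ p, T x ∈ p := by
  induction hT using Algebra.adjoin_induction with
  | mem T hT => rw [Set.mem_singleton_iff.1 hT]; exact hp
  | algebraMap r => intro x hx; exact p.smul_mem r hx
  | add S T _ _ h1 h2 => intro x hx; exact p.add_mem (h1 x hx) (h2 x hx)
  | mul S T _ _ h1 h2 => intro x hx; exact h1 _ (h2 x hx)

theorem IsOpt.re_trace_le [FiniteDimensional ℂ V] {ν : V →ₗ[ℂ] V →ₗ[ℂ] V} {k : ℝ} {n : ℕ}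
    {b : Module.Basis (Fin n) ℂ V} {u : Fin n → ℝ} (h : IsOpt ν k b u) {ψ : Module.End ℂ V}
    (hψ : IsDerivC ν ψ) (hF : ∀ r, ∀ x ∈ fil b u r, ψ x ∈ fil b u r) :
    k * ∑ i, (b.repr (ψ (b i)) i).re ≤ ∑ i, u i * (b.repr (ψ (b i)) i).re := by
  obtain ⟨N, hN, S, hS, hnil, hss, hsum⟩ := Module.End.exists_isNilpotent_isSemisimple (f := ψ)
  have hNS : Commute N S := by
    have h1 : Commute ψ S := Algebra.commute_of_mem_adjoin_self hS
    have h2 : N = ψ - S := by rw [hsum]; abel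
    rw [h2]
    exact h1.sub_left (Commute.refl S)
  have hSF := fun r => mem_of_mem_adjoin hS (hF r)
  have hNF := fun r => mem_of_mem_adjoin hN (hF r)
  obtain ⟨b', l, u', -, hl, hu', -⟩ := exists_adapted_eigenbasis n V
    (by rw [Module.finrank_eq_card_basis b]; simp) S hss _ _ (isFil_fil b u) (isFil_fil b u)
    hSF hSF
  have h' := h.congr hu'
  have hdiag : ∀ i, b'.repr (ψ (b' i)) i = l i + b'.repr (N (b' i)) i := by
    intro i
    rw [hsum]
    simp [hl, add_comm]
  have hw : SupAdd ν (fil b' fun i => (l i).re) := by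
    rw [supAdd_fil_iff]
    intro i j m hm
    have h1 := semisimple_part_product hψ hsum hNS hnil hss (hl i) (hl j)
    have h2 := congrArg (fun z => b'.repr z m) h1
    have h3 : ∀ z, b'.repr (S z) m = l m * b'.repr z m := by
      intro z
      conv_lhs => rw [← b'.sum_repr z, map_sum, map_sum, Finsupp.finsetSum_apply]
      rw [Finset.sum_eq_single m]
      · simp [hl, mul_comm]
      · intro i _ hi
        simp [hl, hi]
      · simp
    simp only [h3, map_smul, Finsupp.smul_apply, smul_eq_mul] at h2
    have h4 := mul_right_cancel₀ hm h2
    rw [h4, Complex.add_re]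
  have hle := h'.inner_ge hw
  have htr : ∀ (β : Module.Basis (Fin n) ℂ V) (X : Module.End ℂ V),
      ∑ i, β.repr (X (β i)) i = LinearMap.trace ℂ V X := by
    intro β X
    rw [LinearMap.trace_eq_matrix_trace ℂ β]
    simp [Matrix.trace, LinearMap.toMatrix_apply]
  have e1 : ∑ i, (b.repr (ψ (b i)) i).re = ∑ i, (l i).re := by
    rw [← Complex.re_sum, htr b ψ, ← htr b' ψ, ← Complex.re_sum]
    congr 1
    simp only [hdiag, Finset.sum_add_distrib]
    have := LinearMap.isNilpotent_trace_of_isNilpotent hnil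
    rw [isNilpotent_iff_eq_zero] at this
    rw [htr b' N, this, add_zero]
  have e2 : ∑ i, u i * (b.repr (ψ (b i)) i).re = ∑ i, u' i * (l i).re := by
    have h1 := sum_weighted_diag_eq hu' hF
    have h2 := sum_weighted_diag_nilpotent (b := b') (u := u') hnil (fun r => hu' r ▸ hNF r)
    simp only [hdiag, mul_add, Finset.sum_add_distrib, h2, add_zero] at h1
    have h3 := congrArg Complex.re h1
    simpa using h3
  rw [e1, e2]
  exact hle

end JordanChevalley

end Derivations

section OptimalWeights

universe v

/-- Optimal weights on a complex Lie algebra with a Hermitian inner product, on an adapted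
orthonormal basis. -/
theorem exists_optimal_orthonormalBasis {W : Type v} [NormedAddCommGroup W]
    [InnerProductSpace ℂ W] [FiniteDimensional ℂ W] {n : ℕ} (hn : Module.finrank ℂ W = n)
    (ν : W →ₗ[ℂ] W →ₗ[ℂ] W) (halt : ∀ x, ν x x = 0) (hjac : ∀ x, IsDerivC ν (ν x))
    {k : ℝ} (hk : 0 < k) :
    ∃ (f : OrthonormalBasis (Fin n) ℂ W) (u : Fin n → ℝ), (∀ i, 0 ≤ u i) ∧
      ∑ i, u i ^ 2 = k * ∑ i, u i ∧
      (∀ i j l, inner ℂ (f l) (ν (f i) (f j)) ≠ 0 → u i + u j ≤ u l) ∧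
      ∀ X : W →ₗ[ℂ] W, IsDerivC ν X →
        (∀ j l, inner ℂ (f l) (X (f j)) ≠ 0 → u j ≤ u l) ∧
        k * ∑ i, (inner ℂ (f i) (X (f i))).re ≤ ∑ i, u i * (inner ℂ (f i) (X (f i))).re := by
  subst hn
  obtain ⟨b, w, hb⟩ := exists_isOpt ν k (Module.finBasis ℂ W)
  obtain ⟨f, u, hf⟩ := exists_adapted_orthonormalBasis _ W rfl _ (isFil_fil b w)
  have h : IsOpt ν k f.toBasis u := hb.congr hf
  have hrepr : ∀ z l, f.toBasis.repr z l = inner ℂ (f l) z := fun z l => by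
    rw [OrthonormalBasis.coe_toBasis_repr_apply, OrthonormalBasis.repr_apply_apply]
  have hder : ∀ X : W →ₗ[ℂ] W, IsDerivC ν X → ∀ j l, inner ℂ (f l) (X (f j)) ≠ 0 → u j ≤ u l := by
    intro X hX j l hjl
    have h1 : f j ∈ fil f.toBasis u (u j) := by
      rw [← OrthonormalBasis.coe_toBasis]
      exact basis_mem_fil.2 le_rfl
    exact h.mem_of_derivation hX h1 l (by rwa [hrepr])
  have hskew : ∀ x y, ν x y = -ν y x := by
    intro x y
    have := halt (x + y)
    simp only [map_add, LinearMap.add_apply, halt, zero_add, add_zero] at this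
    exact eq_neg_of_add_eq_zero_right this
  refine ⟨f, u, h.nonneg hk ?_ ?_, h.sum_sq, ?_, fun X hX => ⟨hder X hX, ?_⟩⟩
  · intro i j l hne
    rw [hrepr, OrthonormalBasis.coe_toBasis] at hne
    exact hder _ (hjac _) j l hne
  · intro i j l hne
    rw [hrepr, OrthonormalBasis.coe_toBasis, hskew, inner_neg_right] at hne
    exact hder _ (hjac _) i l (neg_ne_zero.1 hne)
  · intro i j l hne
    refine supAdd_fil_iff.1 h.compat i j l ?_
    rwa [hrepr, OrthonormalBasis.coe_toBasis]
  · have := h.re_trace_le hX fun r x hx => h.mem_of_derivation hX hx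
    simpa only [hrepr, OrthonormalBasis.coe_toBasis] using this

end OptimalWeights

section LieTheorem

open scoped TensorProduct

universe v w

/-- For a solvable Lie algebra acting on a complex vector space `M`, products of `dim M` elements
of the derived algebra act as zero. -/
theorem prod_toEnd_eq_zero_complex (L : Type v) [LieRing L] [LieAlgebra ℂ L]
    [LieAlgebra.IsSolvable L] (m : ℕ) : ∀ (M : Type w) [AddCommGroup M] [Module ℂ M]
    [LieRingModule L M] [LieModule ℂ L M] [FiniteDimensional ℂ M], Module.finrank ℂ M = m →
    ∀ l : List L, l.length = m → (∀ x ∈ l, x ∈ Submodule.span ℂ {z : L | ∃ x y : L, ⁅x, y⁆ = z}) →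
    (l.map (LieModule.toEnd ℂ L M)).prod = 0 := by
  induction m with
  | zero =>
    intro M _ _ _ _ _ hM l _ _
    have := Module.finrank_zero_iff.1 hM
    exact LinearMap.ext fun x => Subsingleton.elim _ _
  | succ m ih =>
    intro M _ _ _ _ _ hM l hl hmem
    have hnt : Nontrivial M := Module.nontrivial_of_finrank_pos (R := ℂ) (by omega)
    obtain ⟨χ, hχ⟩ := LieModule.exists_nontrivial_weightSpace_of_isSolvable ℂ L M
    obtain ⟨⟨v, hv⟩, hv0⟩ := exists_ne (0 : LieModule.weightSpace M χ)
    rw [LieModule.mem_weightSpace] at hv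
    have hv0' : v ≠ 0 := fun h => hv0 (Subtype.ext h)
    let N : LieSubmodule ℂ L M :=
      { Submodule.span ℂ {v} with
        lie_mem := by
          intro x y hy
          obtain ⟨a, rfl⟩ := Submodule.mem_span_singleton.1 hy
          refine Submodule.mem_span_singleton.2 ⟨a * χ x, ?_⟩
          rw [lie_smul, hv, smul_smul] }
    have hN : ∀ y, y ∈ N ↔ ∃ a : ℂ, a • v = y := fun y => Submodule.mem_span_singleton
    have hkill : ∀ x ∈ Submodule.span ℂ {z : L | ∃ x y : L, ⁅x, y⁆ = z}, ⁅x, v⁆ = 0 := by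
      intro x hx
      induction hx using Submodule.span_induction with
      | mem x hx =>
        obtain ⟨y, z, rfl⟩ := hx
        rw [lie_lie, hv, hv, lie_smul, lie_smul, hv, hv, smul_comm, sub_self]
      | zero => exact zero_lie v
      | add x y _ _ h1 h2 => rw [add_lie, h1, h2, add_zero]
      | smul a x _ h => rw [smul_lie, h, smul_zero]
    have hquot : Module.finrank ℂ (M ⧸ N) = m := by
      have h1 := Submodule.finrank_quotient_add_finrank N.toSubmodule
      have h2 : Module.finrank ℂ N.toSubmodule = 1 := finrank_span_singleton hv0'
      have h3 : Module.finrank ℂ (M ⧸ N) = Module.finrank ℂ (M ⧸ N.toSubmodule) := rfl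
      omega
    rcases l with _ | ⟨a, l⟩
    · simp at hl
    have hprod := ih (M ⧸ N) hquot l (by simpa using hl)
      fun x hx => hmem x (List.mem_cons_of_mem _ hx)
    have hcomp : ∀ (l : List L) (y : M),
        ((l.map (LieModule.toEnd ℂ L (M ⧸ N))).prod) (LieSubmodule.Quotient.mk (N := N) y) =
        LieSubmodule.Quotient.mk (N := N) (((l.map (LieModule.toEnd ℂ L M)).prod) y) := by
      intro l
      induction l with
      | nil => intro y; simp
      | cons b l ihl =>
        intro y
        rw [List.map_cons, List.prod_cons, Module.End.mul_apply, ihl, List.map_cons,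
          List.prod_cons, Module.End.mul_apply]
        rfl
    ext y
    have h1 : ((l.map (LieModule.toEnd ℂ L M)).prod) y ∈ N := by
      refine (LieSubmodule.Quotient.mk_eq_zero (N := N)).1 ((hcomp l y).symm.trans ?_)
      rw [hprod, LinearMap.zero_apply]
    obtain ⟨t, ht⟩ := (hN _).1 h1
    rw [List.map_cons, List.prod_cons, Module.End.mul_apply, ← ht, map_smul,
      LieModule.toEnd_apply_apply, hkill a (hmem a List.mem_cons_self), smul_zero,
      LinearMap.zero_apply]

theorem prod_toEnd_eq_zero_real (L : Type v) [LieRing L] [LieAlgebra ℝ L]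
    [LieAlgebra.IsSolvable L] (M : Type w) [AddCommGroup M] [Module ℝ M]
    [LieRingModule L M] [LieModule ℝ L M] [FiniteDimensional ℝ M]
    (l : List L) (hl : l.length = Module.finrank ℝ M)
    (hmem : ∀ x ∈ l, x ∈ Submodule.span ℝ {z : L | ∃ x y : L, ⁅x, y⁆ = z}) :
    (l.map (LieModule.toEnd ℝ L M)).prod = 0 := by
  have h := prod_toEnd_eq_zero_complex (ℂ ⊗[ℝ] L) (Module.finrank ℝ M) (ℂ ⊗[ℝ] M)
    Module.finrank_baseChange (l.map fun x => (1 : ℂ) ⊗ₜ[ℝ] x) (by simpa using hl) ?_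
  · have hb : ∀ l : List L, ((l.map fun x => (1 : ℂ) ⊗ₜ[ℝ] x).map
        (LieModule.toEnd ℂ (ℂ ⊗[ℝ] L) (ℂ ⊗[ℝ] M))).prod =
        ((l.map (LieModule.toEnd ℝ L M)).prod).baseChange ℂ := by
      intro l
      induction l with
      | nil => simp [Module.End.one_eq_id]
      | cons a l ih =>
        rw [List.map_cons, List.map_cons, List.prod_cons, ih, List.map_cons, List.prod_cons,
          LieModule.toEnd_baseChange, LinearMap.baseChange_mul]
    rw [hb] at h
    ext y
    have h1 := LinearMap.congr_fun h ((1 : ℂ) ⊗ₜ[ℝ] y)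
    rw [LinearMap.baseChange_tmul, LinearMap.zero_apply] at h1
    rw [LinearMap.zero_apply]
    by_contra hne
    have hinj : Function.Injective (fun y : M => (1 : ℂ) ⊗ₜ[ℝ] y) :=
      Module.FaithfullyFlat.tensorProduct_mk_injective (A := ℝ) (B := ℂ) M
    exact hne (hinj (by simpa using h1))
  · intro x hx
    obtain ⟨y, hy, rfl⟩ := List.mem_map.1 hx
    have h1 := hmem y hy
    clear hx hy hmem hl
    induction h1 using Submodule.span_induction with
    | mem y hy =>
      obtain ⟨a, b, rfl⟩ := hy
      refine Submodule.subset_span ⟨1 ⊗ₜ a, 1 ⊗ₜ b, ?_⟩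
      simp
    | zero => simp
    | add x y _ _ h1 h2 =>
      rw [TensorProduct.tmul_add]
      exact Submodule.add_mem _ h1 h2
    | smul a x _ h =>
      have : (1 : ℂ) ⊗ₜ[ℝ] (a • x) = (a : ℂ) • ((1 : ℂ) ⊗ₜ[ℝ] x) := by
        rw [TensorProduct.smul_tmul', ← TensorProduct.smul_tmul]
        simp
      rw [this]
      exact Submodule.smul_mem _ _ h

end LieTheorem

section Nilradical

universe v

variable {E : Type v} [AddCommGroup E] [Module ℝ E] {μ : E →ₗ[ℝ] E →ₗ[ℝ] E}

lemma IsLieBracket.skew (h : IsLieBracket μ) (x y : E) : μ x y = -μ y x := by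
  have := h.1 (x + y)
  simp only [map_add, LinearMap.add_apply, h.1, zero_add, add_zero] at this
  exact eq_neg_of_add_eq_zero_right this

lemma IsLieBracket.isDeriv_ad (h : IsLieBracket μ) (x : E) : IsDeriv μ (μ x) := fun y z => h.2 x y z

/-- The extension of a Lie algebra by a derivation, as a Lie ring structure on `E × ℝ`. -/
@[reducible] def derivExtLieRing (h : IsLieBracket μ) {D : E →ₗ[ℝ] E} (hD : IsDeriv μ D) :
    LieRing (E × ℝ) where
  bracket x y := (μ x.1 y.1 + x.2 • D y.1 - y.2 • D x.1, 0)
  add_lie x y z := by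
    refine Prod.ext ?_ (by simp)
    simp only [Prod.fst_add, Prod.snd_add, map_add, LinearMap.add_apply, add_smul, smul_add]
    abel
  lie_add x y z := by
    refine Prod.ext ?_ (by simp)
    simp only [Prod.fst_add, Prod.snd_add, map_add, add_smul, smul_add]
    abel
  lie_self x := Prod.ext (by simp [h.1]) rfl
  leibniz_lie x y z := by
    refine Prod.ext ?_ (by simp)
    simp only [Prod.fst_add, map_add, map_sub, map_smul, LinearMap.add_apply, LinearMap.sub_apply,
      LinearMap.smul_apply, h.2 x.1 y.1 z.1, hD x.1 y.1, hD x.1 z.1, hD y.1 z.1, smul_add, smul_sub,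
      zero_smul, h.skew (D x.1) y.1]
    rw [h.skew y.1 (D x.1), h.skew (D y.1) z.1, h.skew (D x.1) z.1]
    module

theorem prod_ad_eq_zero [FiniteDimensional ℝ E] (h : IsLieBracket μ) (hsolv : IsSolvableB μ)
    {D : E →ₗ[ℝ] E} (hD : IsDeriv μ D) (l : List E) (hl : l.length = Module.finrank ℝ E)
    (hmem : ∀ x ∈ l, x ∈ Submodule.span ℝ ({z | ∃ x y, μ x y = z} ∪ Set.range D)) :
    (l.map fun x => (μ x : Module.End ℝ E)).prod = 0 := by
  let _ := derivExtLieRing h hD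
  have hbr : ∀ x y : E × ℝ, ⁅x, y⁆ = (μ x.1 y.1 + x.2 • D y.1 - y.2 • D x.1, 0) := fun _ _ => rfl
  let _ : LieAlgebra ℝ (E × ℝ) :=
    { lie_smul := fun t x y => by
        rw [hbr, hbr]
        refine Prod.ext ?_ (by simp)
        simp only [Prod.smul_fst, Prod.smul_snd, map_smul, smul_eq_mul]
        module }
  let _ : LieRingModule (E × ℝ) E :=
    { bracket := fun x y => μ x.1 y + x.2 • D y
      add_lie := fun x y z => by
        change μ (x + y).1 z + (x + y).2 • D z = μ x.1 z + x.2 • D z + (μ y.1 z + y.2 • D z)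
        simp only [Prod.fst_add, Prod.snd_add, map_add, LinearMap.add_apply]
        module
      lie_add := fun x y z => by
        simp only [map_add]
        module
      leibniz_lie := fun x y z => by
        change μ x.1 (μ y.1 z + y.2 • D z) + x.2 • D (μ y.1 z + y.2 • D z) =
          μ (μ x.1 y.1 + x.2 • D y.1 - y.2 • D x.1) z + (0 : ℝ) • D z +
          (μ y.1 (μ x.1 z + x.2 • D z) + y.2 • D (μ x.1 z + x.2 • D z))
        simp only [map_add, map_sub, map_smul, LinearMap.add_apply, LinearMap.sub_apply,
          LinearMap.smul_apply, h.2 x.1 y.1 z, hD y.1 z, hD x.1 z]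
        module }
  have hact : ∀ (x : E × ℝ) (y : E), ⁅x, y⁆ = μ x.1 y + x.2 • D y := fun _ _ => rfl
  let _ : LieModule ℝ (E × ℝ) E :=
    { smul_lie := fun t x y => by
        rw [hact, hact]
        simp only [Prod.smul_fst, Prod.smul_snd, map_smul, LinearMap.smul_apply, smul_eq_mul]
        module
      lie_smul := fun t x y => by
        rw [hact, hact]
        simp only [map_smul]
        module }
  obtain ⟨k, hk⟩ := hsolv
  have hder : ∀ k, ∀ x ∈ LieAlgebra.derivedSeries ℝ (E × ℝ) (k + 1),
      x.2 = 0 ∧ x.1 ∈ derSeries μ k := by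
    intro k
    induction k with
    | zero =>
      intro x hx
      refine ⟨?_, Submodule.mem_top⟩
      rw [LieAlgebra.derivedSeries_def, LieAlgebra.derivedSeriesOfIdeal_succ,
        ← LieSubmodule.mem_toSubmodule, LieSubmodule.lieIdeal_oper_eq_linear_span'] at hx
      induction hx using Submodule.span_induction with
      | mem x hx =>
        obtain ⟨y, _, z, _, rfl⟩ := hx
        rw [hbr]
      | zero => rfl
      | add x y _ _ h1 h2 => rw [Prod.snd_add, h1, h2, add_zero]
      | smul a x _ h => rw [Prod.smul_snd, h, smul_zero]
    | succ k ih =>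
      intro x hx
      rw [LieAlgebra.derivedSeries_def, LieAlgebra.derivedSeriesOfIdeal_succ,
        ← LieSubmodule.mem_toSubmodule, LieSubmodule.lieIdeal_oper_eq_linear_span'] at hx
      induction hx using Submodule.span_induction with
      | mem x hx =>
        obtain ⟨y, hy, z, hz, rfl⟩ := hx
        obtain ⟨hy1, hy2⟩ := ih y hy
        obtain ⟨hz1, hz2⟩ := ih z hz
        rw [hbr]
        refine ⟨rfl, ?_⟩
        simp only [hy1, hz1, zero_smul, add_zero, sub_zero]
        exact Submodule.subset_span ⟨_, hy2, _, hz2, rfl⟩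
      | zero => exact ⟨rfl, Submodule.zero_mem _⟩
      | add x y _ _ h1 h2 =>
        exact ⟨by rw [Prod.snd_add, h1.1, h2.1, add_zero], Submodule.add_mem _ h1.2 h2.2⟩
      | smul a x _ h => exact ⟨by rw [Prod.smul_snd, h.1, smul_zero], Submodule.smul_mem _ _ h.2⟩
  have : LieAlgebra.IsSolvable (E × ℝ) := by
    refine LieAlgebra.IsSolvable.mk (R := ℝ) (k := k + 1) ?_
    rw [LieSubmodule.eq_bot_iff]
    intro x hx
    obtain ⟨h1, h2⟩ := hder k x hx
    rw [hk, Submodule.mem_bot] at h2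
    exact Prod.ext h2 h1
  have hmap : ∀ l : List E, ((l.map fun x => ((x, 0) : E × ℝ)).map
      (LieModule.toEnd ℝ (E × ℝ) E)).prod = (l.map fun x => (μ x : Module.End ℝ E)).prod := by
    intro l
    rw [List.map_map]
    congr 2
    funext x
    ext y
    simp [hact]
  rw [← hmap]
  refine prod_toEnd_eq_zero_real (E × ℝ) E _ (by simpa using hl) ?_
  intro x hx
  obtain ⟨y, hy, rfl⟩ := List.mem_map.1 hx
  have h1 := hmem y hy
  clear hx hy hmem hl
  induction h1 using Submodule.span_induction with
  | mem y hy =>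
    rcases hy with ⟨a, b, rfl⟩ | ⟨a, rfl⟩
    · exact Submodule.subset_span ⟨(a, 0), (b, 0), by rw [hbr]; simp⟩
    · exact Submodule.subset_span ⟨(0, 1), (a, 0), by rw [hbr]; simp⟩
  | zero => exact Submodule.zero_mem _
  | add x y _ _ h1 h2 =>
    have := Submodule.add_mem _ h1 h2
    simpa using this
  | smul a x _ h =>
    have := Submodule.smul_mem _ a h
    simpa using this

lemma lcsOn_prod_apply_eq_zero {p : Submodule ℝ E} {m : ℕ}
    (hp : ∀ l : List E, l.length = m → (∀ x ∈ l, x ∈ p) →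
      (l.map fun x => (μ x : Module.End ℝ E)).prod = 0) (k : ℕ) :
    ∀ l : List E, l.length + k = m → (∀ x ∈ l, x ∈ p) → ∀ z ∈ lcsOn μ p k,
      (l.map fun x => (μ x : Module.End ℝ E)).prod z = 0 := by
  induction k with
  | zero =>
    intro l hl hmem z _
    rw [hp l (by simpa using hl) hmem, LinearMap.zero_apply]
  | succ k ih =>
    intro l hl hmem z hz
    change z ∈ Submodule.span ℝ _ at hz
    induction hz using Submodule.span_induction with
    | mem z hz =>
      obtain ⟨a, ha, y, hy, rfl⟩ := hz
      have := ih (l ++ [a]) (by simp; omega) (by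
        intro x hx
        rcases List.mem_append.1 hx with hx | hx
        · exact hmem x hx
        · rwa [List.mem_singleton.1 hx]) y hy
      simpa using this
    | zero => exact map_zero _
    | add x y _ _ h1 h2 => rw [map_add, h1, h2, add_zero]
    | smul a x _ h => rw [map_smul, h, smul_zero]

lemma isNilpotentOn_of_prod {p : Submodule ℝ E} {m : ℕ}
    (hp : ∀ l : List E, l.length = m → (∀ x ∈ l, x ∈ p) →
      (l.map fun x => (μ x : Module.End ℝ E)).prod = 0) : IsNilpotentOn μ p := by
  refine ⟨m, (Submodule.eq_bot_iff _).2 fun z hz => ?_⟩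
  have := lcsOn_prod_apply_eq_zero hp m [] (by simp) (by simp) z hz
  simpa using this

variable {n : Submodule ℝ E}

theorem IsNilradical.span_le [FiniteDimensional ℝ E] (hn : IsNilradical μ n) (h : IsLieBracket μ)
    (hsolv : IsSolvableB μ) {D : E →ₗ[ℝ] E} (hD : IsDeriv μ D) :
    Submodule.span ℝ ({z | ∃ x y, μ x y = z} ∪ Set.range D) ≤ n :=
  hn.2.2 _ (fun x y _ => Submodule.subset_span (Or.inl ⟨x, y, rfl⟩))
    (isNilpotentOn_of_prod (prod_ad_eq_zero h hsolv hD))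

theorem IsNilradical.bracket_mem [FiniteDimensional ℝ E] (hn : IsNilradical μ n)
    (h : IsLieBracket μ) (hsolv : IsSolvableB μ) (x y : E) : μ x y ∈ n :=
  hn.span_le h hsolv (h.isDeriv_ad 0) (Submodule.subset_span (Or.inl ⟨x, y, rfl⟩))

theorem IsNilradical.deriv_mem [FiniteDimensional ℝ E] (hn : IsNilradical μ n)
    (h : IsLieBracket μ) (hsolv : IsSolvableB μ) {D : E →ₗ[ℝ] E} (hD : IsDeriv μ D) (x : E) :
    D x ∈ n :=
  hn.span_le h hsolv hD (Submodule.subset_span (Or.inr ⟨x, rfl⟩))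

theorem IsNilradical.center_le (hn : IsNilradical μ n) (h : IsLieBracket μ) : centerB μ ≤ n := by
  have hz : ∀ x ∈ centerB μ, ∀ y, μ x y = 0 := fun x hx y => by
    rw [show μ x = 0 from hx, LinearMap.zero_apply]
  refine hn.2.2 _ (fun x y hy => ?_) ⟨1, Submodule.span_eq_bot.2 ?_⟩
  · rw [h.skew, hz y hy, neg_zero]
    exact Submodule.zero_mem _
  · rintro z ⟨x, hx, y, _, rfl⟩
    exact hz x hx y

lemma IsIdeal.lowerCentral (h : IsLieBracket μ) (hn : IsIdeal μ n) (k : ℕ) : IsIdeal μ (lcsOn μ n k) := by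
  induction k with
  | zero => exact hn
  | succ k ih =>
    intro x y hy
    change y ∈ Submodule.span ℝ _ at hy
    induction hy using Submodule.span_induction with
    | mem y hy =>
      obtain ⟨a, ha, b, hb, rfl⟩ := hy
      rw [h.2]
      exact Submodule.add_mem _ (Submodule.subset_span ⟨_, hn x a ha, _, hb, rfl⟩)
        (Submodule.subset_span ⟨_, ha, _, ih x b hb, rfl⟩)
    | zero => rw [map_zero]; exact Submodule.zero_mem _
    | add y z _ _ h1 h2 => rw [map_add]; exact Submodule.add_mem _ h1 h2
    | smul a y _ h => rw [map_smul]; exact Submodule.smul_mem _ _ h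

/-- An operator mapping the whole space to a nilpotent ideal and shifting its lower central series
has vanishing trace. -/
lemma trace_eq_zero_of_lcsOn [FiniteDimensional ℝ E] (hn : IsNilpotentOn μ n) {T : E →ₗ[ℝ] E}
    (h0 : ∀ x, T x ∈ n) (hk : ∀ k, ∀ x ∈ lcsOn μ n k, T x ∈ lcsOn μ n (k + 1)) :
    LinearMap.trace ℝ E T = 0 := by
  obtain ⟨m, hm⟩ := hn
  have hpow : ∀ k x, ((T : Module.End ℝ E) ^ (k + 1)) x ∈ lcsOn μ n k := by
    intro k x
    induction k with
    | zero => rw [zero_add, pow_one]; exact h0 x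
    | succ k ih =>
      rw [pow_succ']
      exact hk k _ ih
  have hnil : IsNilpotent (T : Module.End ℝ E) :=
    ⟨m + 1, LinearMap.ext fun x => by
      have := hpow m x
      rw [hm, Submodule.mem_bot] at this
      rw [this, LinearMap.zero_apply]⟩
  have := LinearMap.isNilpotent_trace_of_isNilpotent hnil
  rwa [isNilpotent_iff_eq_zero] at this

theorem IsNilradical.trace_ad_comp_ad_eq_zero [FiniteDimensional ℝ E] (hn : IsNilradical μ n)
    (h : IsLieBracket μ) {x : E} (hx : x ∈ n) (y : E) :
    LinearMap.trace ℝ E (μ x ∘ₗ μ y) = 0 :=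
  trace_eq_zero_of_lcsOn hn.2.1
    (fun z => by rw [LinearMap.comp_apply, h.skew]; exact n.neg_mem (hn.1 _ x hx))
    (fun k z hz => Submodule.subset_span ⟨x, hx, _, hn.1.lowerCentral h k y z hz, rfl⟩)

end Nilradical

section HilbertSchmidt

variable {𝕜 V V' ι κ : Type*} [RCLike 𝕜] [NormedAddCommGroup V] [InnerProductSpace 𝕜 V]
  [FiniteDimensional 𝕜 V] [NormedAddCommGroup V'] [InnerProductSpace 𝕜 V'] [FiniteDimensional 𝕜 V']
  [Fintype ι] [Fintype κ]

lemma sum_norm_sq_eq_sum_norm_adjoint_sq (T : V →ₗ[𝕜] V') (f : OrthonormalBasis ι 𝕜 V)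
    (g : OrthonormalBasis κ 𝕜 V') :
    ∑ i, ‖T (f i)‖ ^ 2 = ∑ j, ‖LinearMap.adjoint T (g j)‖ ^ 2 := by
  simp_rw [← g.sum_sq_norm_inner_right (T (f _)), ← f.sum_sq_norm_inner_left (LinearMap.adjoint T _),
    LinearMap.adjoint_inner_left]
  exact Finset.sum_comm

lemma sum_norm_sq_eq_sum_norm_sq (T : V →ₗ[𝕜] V') (f : OrthonormalBasis ι 𝕜 V)
    (g : OrthonormalBasis κ 𝕜 V) : ∑ i, ‖T (f i)‖ ^ 2 = ∑ j, ‖T (g j)‖ ^ 2 := by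
  rw [sum_norm_sq_eq_sum_norm_adjoint_sq T f (stdOrthonormalBasis 𝕜 V'),
    sum_norm_sq_eq_sum_norm_adjoint_sq T g (stdOrthonormalBasis 𝕜 V')]

end HilbertSchmidt

section RealBasics

universe v

variable {E : Type v} [NormedAddCommGroup E] [InnerProductSpace ℝ E] [FiniteDimensional ℝ E]
  {μ : E →ₗ[ℝ] E →ₗ[ℝ] E}

lemma transp_inner_left (f : E →ₗ[ℝ] E) (x y : E) : ⟪transp f x, y⟫ = ⟪x, f y⟫ :=
  LinearMap.adjoint_inner_left f y x

lemma transp_inner_right (f : E →ₗ[ℝ] E) (x y : E) : ⟪x, transp f y⟫ = ⟪f x, y⟫ :=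
  LinearMap.adjoint_inner_right f x y

lemma transp_transp (f : E →ₗ[ℝ] E) : transp (transp f) = f := LinearMap.adjoint_adjoint f

lemma transp_comp (f g : E →ₗ[ℝ] E) : transp (f ∘ₗ g) = transp g ∘ₗ transp f :=
  LinearMap.adjoint_comp f g

lemma transp_add (f g : E →ₗ[ℝ] E) : transp (f + g) = transp f + transp g :=
  map_add LinearMap.adjoint f g

lemma transp_sub (f g : E →ₗ[ℝ] E) : transp (f - g) = transp f - transp g :=
  map_sub LinearMap.adjoint f g

lemma transp_smul (t : ℝ) (f : E →ₗ[ℝ] E) : transp (t • f) = t • transp f := by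
  refine LinearMap.ext fun x => ext_inner_right ℝ fun y => ?_
  simp only [transp_inner_left, LinearMap.smul_apply, inner_smul_left, inner_smul_right]
  rfl

lemma transp_sum {ι : Type*} (s : Finset ι) (f : ι → E →ₗ[ℝ] E) :
    transp (∑ i ∈ s, f i) = ∑ i ∈ s, transp (f i) :=
  map_sum (LinearMap.adjoint (𝕜 := ℝ) (E := E) (F := E)) f s

lemma trace_eq_sum_stdONB (f : E →ₗ[ℝ] E) :
    LinearMap.trace ℝ E f = ∑ i, ⟪f (stdONB E i), stdONB E i⟫ := by
  rw [LinearMap.trace_eq_sum_inner f (stdONB E)]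
  exact Finset.sum_congr rfl fun i _ => real_inner_comm _ _

lemma trace_transp (f : E →ₗ[ℝ] E) : LinearMap.trace ℝ E (transp f) = LinearMap.trace ℝ E f := by
  rw [trace_eq_sum_stdONB, trace_eq_sum_stdONB]
  exact Finset.sum_congr rfl fun i _ => by rw [transp_inner_left, real_inner_comm]

/-- An operator equal to its transpose is determined by its quadratic form. -/
lemma eq_of_inner_self_eq {f g : E →ₗ[ℝ] E} (hf : transp f = f) (hg : transp g = g)
    (h : ∀ x, ⟪f x, x⟫ = ⟪g x, x⟫) : f = g := by
  have hs : (f - g).IsSymmetric := fun x y => by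
    rw [← transp_inner_left, transp_sub, hf, hg]
  rw [← sub_eq_zero]
  refine hs.inner_map_self_eq_zero.1 fun x => ?_
  rw [LinearMap.sub_apply, inner_sub_left, h, sub_self]

lemma eq_zero_of_trace_comp_self {f : E →ₗ[ℝ] E} (hf : transp f = f)
    (h : LinearMap.trace ℝ E (f ∘ₗ f) ≤ 0) : f = 0 := by
  have h1 : LinearMap.trace ℝ E (f ∘ₗ f) = ∑ i, ‖f (stdONB E i)‖ ^ 2 := by
    rw [trace_eq_sum_stdONB]
    refine Finset.sum_congr rfl fun i _ => ?_
    rw [LinearMap.comp_apply]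
    nth_rewrite 1 [← hf]
    rw [transp_inner_left, real_inner_self_eq_norm_sq]
  have h2 : ∀ i, ‖f (stdONB E i)‖ ^ 2 = 0 := fun i =>
    (Finset.sum_eq_zero_iff_of_nonneg fun i _ => by positivity).1
      (le_antisymm (h1 ▸ h) (Finset.sum_nonneg fun i _ => by positivity)) i (Finset.mem_univ i)
  refine (stdONB E).toBasis.ext fun i => ?_
  simpa using h2 i

lemma transp_Rop (μ : E →ₗ[ℝ] E →ₗ[ℝ] E) : transp (Rop μ) = Rop μ := by
  simp only [Rop, transp_add, transp_smul, transp_sum, transp_comp, transp_transp]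

lemma inner_Rop_self (μ : E →ₗ[ℝ] E →ₗ[ℝ] E) (x : E) :
    ⟪Rop μ x, x⟫ = (1 / 4 : ℝ) * ∑ i, ‖transp (μ (stdONB E i)) x‖ ^ 2 -
      (1 / 2 : ℝ) * ∑ i, ‖μ (stdONB E i) x‖ ^ 2 := by
  simp only [Rop, LinearMap.add_apply, LinearMap.smul_apply, LinearMap.sum_apply,
    LinearMap.comp_apply, inner_add_left, real_inner_smul_left, sum_inner,
    ← real_inner_self_eq_norm_sq]
  have h1 : ∀ T : E →ₗ[ℝ] E, ⟪transp T (T x), x⟫ = ⟪T x, T x⟫ := fun T => transp_inner_left T _ _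
  have h2 : ∀ T : E →ₗ[ℝ] E, ⟪T (transp T x), x⟫ = ⟪transp T x, transp T x⟫ :=
    fun T => (transp_inner_right T _ _).symm
  simp only [h1, h2]
  ring

lemma trace_Rop_comp (μ : E →ₗ[ℝ] E →ₗ[ℝ] E) (hμ : ∀ x y, μ x y = -μ y x) (G : E →ₗ[ℝ] E) :
    LinearMap.trace ℝ E (Rop μ ∘ₗ G) = (1 / 4 : ℝ) * binner (piAct G μ) μ := by
  have h1 : ∀ T : E →ₗ[ℝ] E, LinearMap.trace ℝ E (transp T ∘ₗ T ∘ₗ G) =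
      ∑ j, ⟪T (G (stdONB E j)), T (stdONB E j)⟫ := fun T => by
    rw [trace_eq_sum_stdONB]
    exact Finset.sum_congr rfl fun i _ => by rw [LinearMap.comp_apply, transp_inner_left]; rfl
  have h2 : ∀ T : E →ₗ[ℝ] E, LinearMap.trace ℝ E (T ∘ₗ transp T ∘ₗ G) =
      ∑ j, ⟪G (T (stdONB E j)), T (stdONB E j)⟫ := fun T => by
    rw [LinearMap.trace_comp_comm', LinearMap.comp_assoc, trace_eq_sum_stdONB]
    exact Finset.sum_congr rfl fun i _ => by rw [LinearMap.comp_apply, transp_inner_left]; rfl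
  have h3 : LinearMap.trace ℝ E (Rop μ ∘ₗ G) =
      -(1 / 2 : ℝ) * ∑ i, ∑ j, ⟪μ (stdONB E i) (G (stdONB E j)), μ (stdONB E i) (stdONB E j)⟫ +
      (1 / 4 : ℝ) * ∑ i, ∑ j, ⟪G (μ (stdONB E i) (stdONB E j)), μ (stdONB E i) (stdONB E j)⟫ := by
    have h5 : ∀ f : Fin (Module.finrank ℝ E) → E →ₗ[ℝ] E, (∑ i, f i) ∘ₗ G = ∑ i, f i ∘ₗ G :=
      fun f => by ext x; simp
    simp only [Rop, LinearMap.add_comp, LinearMap.smul_comp, map_add, map_smul, smul_eq_mul,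
      ← h1, ← h2, h5, map_sum, LinearMap.comp_assoc]
  have h4 : ∑ i, ∑ j, ⟪μ (G (stdONB E i)) (stdONB E j), μ (stdONB E i) (stdONB E j)⟫ =
      ∑ i, ∑ j, ⟪μ (stdONB E i) (G (stdONB E j)), μ (stdONB E i) (stdONB E j)⟫ := by
    rw [Finset.sum_comm]
    refine Finset.sum_congr rfl fun i _ => Finset.sum_congr rfl fun j _ => ?_
    rw [hμ (G _), hμ (stdONB E j), inner_neg_neg]
  rw [h3]
  simp only [binner, piAct, LinearMap.sub_apply, inner_sub_left, Finset.sum_sub_distrib,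
    LinearMap.comp_apply, LinearMap.llcomp_apply, LinearMap.lcomp_apply, h4]
  ring

omit [FiniteDimensional ℝ E] in
lemma piAct_apply (f : E →ₗ[ℝ] E) (μ : E →ₗ[ℝ] E →ₗ[ℝ] E) (x y : E) :
    piAct f μ x y = f (μ x y) - μ (f x) y - μ x (f y) := rfl

lemma trace_Rop_comp_eq_zero (hμ : ∀ x y, μ x y = -μ y x) {G : E →ₗ[ℝ] E} (hG : IsDeriv μ G) :
    LinearMap.trace ℝ E (Rop μ ∘ₗ G) = 0 := by
  have : piAct G μ = 0 := by
    ext x y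
    rw [piAct_apply, hG]
    simp
  rw [trace_Rop_comp μ hμ, this]
  simp [binner]

lemma sum_comp_transp (β : E →ₗ[ℝ] E →ₗ[ℝ] ℝ) (f : E →ₗ[ℝ] E) :
    ∑ i, β (f (stdONB E i)) (stdONB E i) = ∑ i, β (stdONB E i) (transp f (stdONB E i)) := by
  have h1 : ∀ i, f (stdONB E i) = ∑ j, ⟪stdONB E j, f (stdONB E i)⟫ • stdONB E j :=
    fun i => ((stdONB E).sum_repr' _).symm
  have h2 : ∀ i, transp f (stdONB E i) = ∑ j, ⟪stdONB E j, transp f (stdONB E i)⟫ • stdONB E j :=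
    fun i => ((stdONB E).sum_repr' _).symm
  conv_lhs => enter [2, i]; rw [h1 i]
  conv_rhs => enter [2, i]; rw [h2 i]
  simp only [map_sum, map_smul, LinearMap.sum_apply, LinearMap.smul_apply, transp_inner_right]
  rw [Finset.sum_comm]
  exact Finset.sum_congr rfl fun i _ => Finset.sum_congr rfl fun j _ => by rw [real_inner_comm]

lemma binner_piAct_left (f : E →ₗ[ℝ] E) (μ ν : E →ₗ[ℝ] E →ₗ[ℝ] E) :
    binner (piAct f μ) ν = binner μ (piAct (transp f) ν) := by
  have h1 : ∀ y, ∑ i, ⟪μ (f (stdONB E i)) y, ν (stdONB E i) y⟫ =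
      ∑ i, ⟪μ (stdONB E i) y, ν (transp f (stdONB E i)) y⟫ := fun y =>
    sum_comp_transp ((innerₗ E).compl₁₂ (μ.flip y) (ν.flip y)) f
  have h2 : ∀ x, ∑ i, ⟪μ x (f (stdONB E i)), ν x (stdONB E i)⟫ =
      ∑ i, ⟪μ x (stdONB E i), ν x (transp f (stdONB E i))⟫ := fun x =>
    sum_comp_transp ((innerₗ E).compl₁₂ (μ x) (ν x)) f
  simp only [binner, piAct_apply, inner_sub_left, inner_sub_right, Finset.sum_sub_distrib, h2,
    transp_inner_right]
  congr 2
  rw [Finset.sum_comm]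
  conv_rhs => rw [Finset.sum_comm]
  exact Finset.sum_congr rfl fun i _ => h1 _

lemma trace_Rop_comp_commutator_nonneg (hμ : ∀ x y, μ x y = -μ y x) {G : E →ₗ[ℝ] E}
    (hG : IsDeriv μ G) :
    0 ≤ LinearMap.trace ℝ E (Rop μ ∘ₗ (G ∘ₗ transp G - transp G ∘ₗ G)) := by
  have h0 : piAct G μ = 0 := by
    ext x y
    rw [piAct_apply, hG]
    simp
  have h1 : piAct (G ∘ₗ transp G - transp G ∘ₗ G) μ =
      piAct G (piAct (transp G) μ) - piAct (transp G) (piAct G μ) := by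
    ext x y
    simp only [piAct_apply, LinearMap.sub_apply, LinearMap.comp_apply, map_sub]
    abel
  have h2 : piAct (transp G) (0 : E →ₗ[ℝ] E →ₗ[ℝ] E) = 0 := by
    ext x y
    simp [piAct_apply]
  rw [trace_Rop_comp μ hμ, h1, h0, h2, sub_zero, binner_piAct_left]
  refine mul_nonneg (by norm_num) (Finset.sum_nonneg fun i _ => Finset.sum_nonneg fun j _ => ?_)
  exact real_inner_self_nonneg

end RealBasics

section Projection

universe v

variable {E : Type v} [NormedAddCommGroup E] [InnerProductSpace ℝ E] [FiniteDimensional ℝ E]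
  {p q : Submodule ℝ E}

lemma projL_apply (p : Submodule ℝ E) (x : E) : projL p x = p.starProjection x := rfl

lemma projL_mem (p : Submodule ℝ E) (x : E) : projL p x ∈ p := Subtype.prop _

lemma projL_of_mem {x : E} (hx : x ∈ p) : projL p x = x :=
  Submodule.starProjection_eq_self_iff.2 hx

lemma projL_projL (p : Submodule ℝ E) (x : E) : projL p (projL p x) = projL p x :=
  projL_of_mem (projL_mem p x)

lemma transp_projL (p : Submodule ℝ E) : transp (projL p) = projL p :=
  LinearMap.ext fun x => ext_inner_right ℝ fun y => by
    rw [transp_inner_left, projL_apply, projL_apply, Submodule.inner_starProjection_left_eq_right]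

lemma projL_add_projL_orthogonal (p : Submodule ℝ E) (x : E) : projL p x + projL pᗮ x = x :=
  Submodule.starProjection_add_starProjection_orthogonal x

lemma projL_of_mem_orthogonal {x : E} (hx : x ∈ pᗮ) : projL p x = 0 := by
  have := projL_add_projL_orthogonal p x
  rwa [projL_of_mem hx, add_eq_right] at this

lemma norm_sq_eq_projL_add (p : Submodule ℝ E) (x : E) :
    ‖x‖ ^ 2 = ‖projL p x‖ ^ 2 + ‖projL pᗮ x‖ ^ 2 := by
  conv_lhs => rw [← projL_add_projL_orthogonal p x]
  have := (Submodule.mem_orthogonal p _).1 (projL_mem pᗮ x) _ (projL_mem p x)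
  rw [@norm_add_sq ℝ, this]
  simp

lemma norm_projL_le_of_le (h : p ≤ q) (x : E) : ‖projL p x‖ ^ 2 ≤ ‖projL q x‖ ^ 2 := by
  have h1 : projL p (projL q x) = projL p x := by
    conv_rhs => rw [← projL_add_projL_orthogonal q x, map_add,
      projL_of_mem_orthogonal (Submodule.orthogonal_le h (projL_mem qᗮ x)), add_zero]
  rw [← h1, norm_sq_eq_projL_add p (projL q x)]
  exact le_add_of_nonneg_right (by positivity)

lemma sum_norm_projL_sq (T : E →ₗ[ℝ] E) (p : Submodule ℝ E) :
    ∑ i, ‖T (projL p (stdONB E i))‖ ^ 2 = ∑ i, ‖projL p (transp T (stdONB E i))‖ ^ 2 := by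
  have := sum_norm_sq_eq_sum_norm_adjoint_sq (T ∘ₗ projL p) (stdONB E) (stdONB E)
  rw [← transp, transp_comp, transp_projL] at this
  exact this

lemma sum_norm_sq_eq_projL_add (T : E →ₗ[ℝ] E) (p : Submodule ℝ E) :
    ∑ i, ‖T (stdONB E i)‖ ^ 2 =
      ∑ i, ‖T (projL p (stdONB E i))‖ ^ 2 + ∑ i, ‖T (projL pᗮ (stdONB E i))‖ ^ 2 := by
  rw [sum_norm_projL_sq, sum_norm_projL_sq, ← Finset.sum_add_distrib,
    sum_norm_sq_eq_sum_norm_adjoint_sq T (stdONB E) (stdONB E)]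
  exact Finset.sum_congr rfl fun i _ => norm_sq_eq_projL_add p _

lemma sum_norm_projL_sq_le (T : E →ₗ[ℝ] E) (h : p ≤ q) :
    ∑ i, ‖T (projL p (stdONB E i))‖ ^ 2 ≤ ∑ i, ‖T (projL q (stdONB E i))‖ ^ 2 := by
  rw [sum_norm_projL_sq, sum_norm_projL_sq]
  exact Finset.sum_le_sum fun i _ => norm_projL_le_of_le h _

lemma sum_norm_onbOf_sq (T : E →ₗ[ℝ] E) (p : Submodule ℝ E) :
    ∑ i, ‖T (onbOf p i)‖ ^ 2 = ∑ i, ‖T (projL p (stdONB E i))‖ ^ 2 := by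
  have h1 := sum_norm_sq_eq_sum_norm_adjoint_sq (T ∘ₗ p.subtype) (stdOrthonormalBasis ℝ p) (stdONB E)
  have h2 : ∀ x : E, LinearMap.adjoint (T ∘ₗ p.subtype) x =
      Submodule.orthogonalProjectionOnto p (transp T x) := fun x => by
    refine ext_inner_right ℝ fun y => ?_
    rw [LinearMap.adjoint_inner_left]
    change ⟪x, T y⟫ = _
    rw [← transp_inner_left, Submodule.inner_orthogonalProjectionOnto_eq_of_mem_right]
  rw [sum_norm_projL_sq]
  refine h1.trans (Finset.sum_congr rfl fun i _ => ?_)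
  rw [h2]
  rfl

end Projection

section RicciBasics

universe v

variable {E : Type v} [NormedAddCommGroup E] [InnerProductSpace ℝ E] [FiniteDimensional ℝ E]
  {μ : E →ₗ[ℝ] E →ₗ[ℝ] E}

lemma inner_Bop (μ : E →ₗ[ℝ] E →ₗ[ℝ] E) (x y : E) :
    ⟪Bop μ x, y⟫ = LinearMap.trace ℝ E (μ x ∘ₗ μ y) := by
  have h1 : y = ∑ i, ⟪stdONB E i, y⟫ • stdONB E i := ((stdONB E).sum_repr' y).symm
  have h2 : LinearMap.trace ℝ E (μ x ∘ₗ μ y) =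
      (LinearMap.trace ℝ E ∘ₗ LinearMap.llcomp ℝ E E E (μ x) ∘ₗ μ) y := rfl
  rw [h2]
  conv_rhs => rw [h1]
  simp only [Bop, LinearMap.sum_apply, LinearMap.smulRight_apply, sum_inner, real_inner_smul_left,
    map_sum, map_smul, smul_eq_mul]
  refine Finset.sum_congr rfl fun i _ => ?_
  rw [mul_comm]
  rfl

lemma transp_Bop (μ : E →ₗ[ℝ] E →ₗ[ℝ] E) : transp (Bop μ) = Bop μ := by
  refine LinearMap.ext fun x => ext_inner_right ℝ fun y => ?_
  rw [transp_inner_left, real_inner_comm, inner_Bop, inner_Bop, LinearMap.trace_comp_comm']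

lemma transp_symPart (f : E →ₗ[ℝ] E) : transp (symPart f) = symPart f := by
  rw [symPart, transp_smul, transp_add, transp_transp, add_comm]

lemma inner_symPart_self (f : E →ₗ[ℝ] E) (x : E) : ⟪symPart f x, x⟫ = ⟪f x, x⟫ := by
  rw [symPart, LinearMap.smul_apply, LinearMap.add_apply, real_inner_smul_left, inner_add_left,
    transp_inner_left, real_inner_comm]
  ring

lemma trace_symPart (f : E →ₗ[ℝ] E) :
    LinearMap.trace ℝ E (symPart f) = LinearMap.trace ℝ E f := by
  rw [symPart, map_smul, map_add, trace_transp, smul_eq_mul]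
  ring

lemma trace_symPart_comp_symPart (f : E →ₗ[ℝ] E) :
    LinearMap.trace ℝ E (symPart f ∘ₗ symPart f) = LinearMap.trace ℝ E (symPart f ∘ₗ f) := by
  have h : LinearMap.trace ℝ E (symPart f ∘ₗ transp f) = LinearMap.trace ℝ E (symPart f ∘ₗ f) := by
    rw [← trace_transp, transp_comp, transp_transp, transp_symPart, LinearMap.trace_comp_comm']
  have h2 : symPart f ∘ₗ symPart f = symPart f ∘ₗ ((1 / 2 : ℝ) • (f + transp f)) := rfl
  rw [h2, LinearMap.comp_smul, LinearMap.comp_add, map_smul, map_add, h, smul_eq_mul]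
  ring

omit [FiniteDimensional ℝ E] in
lemma IsDeriv.add {D D' : E →ₗ[ℝ] E} (h : IsDeriv μ D) (h' : IsDeriv μ D') : IsDeriv μ (D + D') := by
  intro x y
  simp only [LinearMap.add_apply, h x y, h' x y, map_add]
  abel

/-- The derivation `ad H + D` of a solsoliton and its symmetric part. -/
theorem solsoliton_symPart (hLie : IsLieBracket μ) (hsolv : IsSolvableB μ)
    {n : Submodule ℝ E} (hn : IsNilradical μ n) {c : ℝ} {D : E →ₗ[ℝ] E} (hD : IsDeriv μ D)
    (hRic : Ric μ = c • LinearMap.id + D) :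
    IsDeriv μ (μ (meanCurv μ) + D) ∧ (∀ x, (μ (meanCurv μ) + D) x ∈ n) ∧
    (∀ x ∈ n, Bop μ x = 0) ∧
    c • LinearMap.id + symPart (μ (meanCurv μ) + D) = Rop μ - (1 / 2 : ℝ) • Bop μ ∧
    LinearMap.trace ℝ E (symPart (μ (meanCurv μ) + D) ∘ₗ symPart (μ (meanCurv μ) + D)) =
      -c * LinearMap.trace ℝ E (symPart (μ (meanCurv μ) + D)) := by
  set ψ := μ (meanCurv μ) + D with hψ
  have h1 : IsDeriv μ ψ := (hLie.isDeriv_ad _).add hD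
  have h2 : ∀ x, ψ x ∈ n := fun x => hn.deriv_mem hLie hsolv h1 x
  have h3 : ∀ x ∈ n, Bop μ x = 0 := fun x hx => ext_inner_right ℝ fun y => by
    rw [inner_Bop, hn.trace_ad_comp_ad_eq_zero hLie hx, inner_zero_left]
  have hDs : D = Rop μ - (1 / 2 : ℝ) • Bop μ - symPart (μ (meanCurv μ)) - c • LinearMap.id := by
    rw [← Ric, hRic]
    abel
  have hid : transp (LinearMap.id : E →ₗ[ℝ] E) = LinearMap.id := LinearMap.adjoint_id
  have hDt : transp D = D := by
    rw [hDs]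
    simp only [transp_sub, transp_smul, transp_symPart, transp_Rop, transp_Bop, hid]
  have h4 : symPart ψ = symPart (μ (meanCurv μ)) + D := by
    rw [hψ, symPart, symPart, transp_add, hDt]
    module
  have h5 : c • LinearMap.id + symPart ψ = Rop μ - (1 / 2 : ℝ) • Bop μ := by
    rw [h4, hDs]
    abel
  refine ⟨h1, h2, h3, h5, ?_⟩
  have h6 : Bop μ ∘ₗ ψ = 0 := LinearMap.ext fun x => h3 _ (h2 x)
  have h7 := congrArg (fun T => LinearMap.trace ℝ E (T ∘ₗ ψ)) h5
  simp only [LinearMap.add_comp, LinearMap.sub_comp, LinearMap.smul_comp, h6, LinearMap.id_comp,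
    smul_zero, sub_zero, map_add, map_smul, smul_eq_mul] at h7
  rw [trace_Rop_comp_eq_zero hLie.skew h1] at h7
  rw [trace_symPart_comp_symPart, trace_symPart]
  linarith

end RicciBasics

section ComplexOptimal

universe v

variable {V : Type v} [NormedAddCommGroup V] [InnerProductSpace ℂ V] [FiniteDimensional ℂ V]
  {κ : Type*} [Fintype κ]

/-- Orthonormal bases of a subspace and of its orthogonal complement combine to an orthonormal
basis. -/
lemma exists_orthonormalBasis_sum {W : Submodule ℂ V} {p q : ℕ}
    (f : OrthonormalBasis (Fin p) ℂ W) (h : OrthonormalBasis (Fin q) ℂ Wᗮ) :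
    ∃ b : OrthonormalBasis (Fin p ⊕ Fin q) ℂ V,
      (∀ i, b (Sum.inl i) = (f i : V)) ∧ ∀ i, b (Sum.inr i) = (h i : V) := by
  set v : Fin p ⊕ Fin q → V := Sum.elim (fun i => (f i : V)) (fun i => (h i : V)) with hv
  have ho : Orthonormal ℂ v := by
    rw [orthonormal_iff_ite]
    rintro (i | i) (j | j)
    · simpa [hv] using orthonormal_iff_ite.1 f.orthonormal i j
    · simpa [hv] using (Submodule.mem_orthogonal W _).1 (h j).2 _ (f i).2
    · simpa [hv] using (Submodule.mem_orthogonal' W _).1 (h i).2 _ (f j).2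
    · simpa [hv] using orthonormal_iff_ite.1 h.orthonormal i j
  have hcard : Fintype.card (Fin p ⊕ Fin q) = Module.finrank ℂ V := by
    rw [← W.finrank_add_finrank_orthogonal, Module.finrank_eq_card_basis f.toBasis,
      Module.finrank_eq_card_basis h.toBasis, Fintype.card_sum]
  have hsp := ho.linearIndependent.span_eq_top_of_card_eq_finrank' hcard
  refine ⟨OrthonormalBasis.mk ho hsp.ge, fun i => ?_, fun i => ?_⟩ <;> simp [hv]

lemma sum_weight_ricci {ι : Type*} [Fintype ι] {μ : V →ₗ[ℂ] V →ₗ[ℂ] V} (halt : ∀ x, μ x x = 0)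
    (g : OrthonormalBasis κ ℂ V) (b : OrthonormalBasis ι ℂ V) (w : ι → ℝ) :
    ∑ l, w l * ((1 / 4 : ℝ) * ∑ i, ‖LinearMap.adjoint (μ (g i)) (b l)‖ ^ 2 -
      (1 / 2 : ℝ) * ∑ i, ‖μ (g i) (b l)‖ ^ 2) =
    (1 / 4 : ℝ) * ∑ i, ∑ j, ∑ l, (w l - w i - w j) * ‖inner ℂ (b l) (μ (b i) (b j))‖ ^ 2 := by
  have hskew : ∀ x y, μ x y = -μ y x := fun x y => by
    have := halt (x + y)
    simp only [map_add, LinearMap.add_apply, halt, zero_add, add_zero] at this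
    exact eq_neg_of_add_eq_zero_right this
  have hc : ∀ i j l, ‖inner ℂ (b l) (μ (b i) (b j))‖ ^ 2 =
      ‖inner ℂ (b l) (μ (b j) (b i))‖ ^ 2 := fun i j l => by
    rw [hskew, inner_neg_right, norm_neg]
  have h1 : ∀ l, ∑ i, ‖μ (g i) (b l)‖ ^ 2 =
      ∑ j, ∑ i, ‖inner ℂ (b i) (μ (b l) (b j))‖ ^ 2 := fun l => by
    simp_rw [hskew (g _), norm_neg, sum_norm_sq_eq_sum_norm_sq (μ (b l)) g b]
    exact Finset.sum_congr rfl fun j _ => (b.sum_sq_norm_inner_right _).symm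
  have h2 : ∀ l, ∑ i, ‖LinearMap.adjoint (μ (g i)) (b l)‖ ^ 2 =
      ∑ i, ∑ j, ‖inner ℂ (b l) (μ (b i) (b j))‖ ^ 2 := fun l => by
    have h3 : ∀ i, ‖LinearMap.adjoint (μ (g i)) (b l)‖ ^ 2 =
        ∑ j, ‖inner ℂ (LinearMap.adjoint (μ (b j)) (b l)) (g i)‖ ^ 2 := fun i => by
      rw [← b.sum_sq_norm_inner_left]
      refine Finset.sum_congr rfl fun j _ => ?_
      rw [LinearMap.adjoint_inner_left, LinearMap.adjoint_inner_left, hskew, inner_neg_right,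
        norm_neg]
    simp_rw [h3]
    rw [Finset.sum_comm]
    refine Finset.sum_congr rfl fun i _ => ?_
    rw [g.sum_sq_norm_inner_left, ← b.sum_sq_norm_inner_left]
    exact Finset.sum_congr rfl fun j _ => by rw [LinearMap.adjoint_inner_left]
  have h4 : ∑ i, ∑ j, ∑ l, w j * ‖inner ℂ (b l) (μ (b i) (b j))‖ ^ 2 =
      ∑ i, ∑ j, ∑ l, w i * ‖inner ℂ (b l) (μ (b i) (b j))‖ ^ 2 := by
    rw [Finset.sum_comm]
    refine Finset.sum_congr rfl fun i _ => Finset.sum_congr rfl fun j _ =>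
      Finset.sum_congr rfl fun l _ => by rw [hc]
  have h5 : ∑ i, ∑ j, ∑ l, w l * ‖inner ℂ (b l) (μ (b i) (b j))‖ ^ 2 =
      ∑ l, ∑ i, ∑ j, w l * ‖inner ℂ (b l) (μ (b i) (b j))‖ ^ 2 := by
    rw [Finset.sum_comm (s := (Finset.univ : Finset ι)) (t := (Finset.univ : Finset ι))
      (f := fun l i => ∑ j, w l * ‖inner ℂ (b l) (μ (b i) (b j))‖ ^ 2)]
    exact Finset.sum_congr rfl fun i _ => Finset.sum_comm
  have h6 : ∀ A B : ι → ℝ, ∑ l, w l * ((1 / 4 : ℝ) * A l - (1 / 2 : ℝ) * B l) =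
      (1 / 4 : ℝ) * ∑ l, w l * A l - (1 / 2 : ℝ) * ∑ l, w l * B l := fun A B => by
    rw [Finset.mul_sum, Finset.mul_sum, ← Finset.sum_sub_distrib]
    exact Finset.sum_congr rfl fun l _ => by ring
  have h7 : ∀ A : ι → ι → ι → ℝ, ∑ l, w l * ∑ i, ∑ j, A l i j = ∑ l, ∑ i, ∑ j, w l * A l i j :=
    fun A => by simp only [Finset.mul_sum]
  simp only [h1, h2]
  rw [h6, h7, h7]
  simp only [sub_mul, Finset.sum_sub_distrib, h4, h5]
  ring

/-- A family of weights adapted to a Lie algebra and to its Ricci-type operator is realised by that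
operator. -/
theorem eq_weights_of_ricci {ι : Type*} [Fintype ι] {μ : V →ₗ[ℂ] V →ₗ[ℂ] V} (halt : ∀ x, μ x x = 0)
    (g : OrthonormalBasis κ ℂ V) (b : OrthonormalBasis ι ℂ V) (w : ι → ℝ) {k : ℝ}
    (hsum : ∑ i, w i ^ 2 = k * ∑ i, w i)
    (hadapt : ∀ i j l, inner ℂ (b l) (μ (b i) (b j)) ≠ 0 → w i + w j ≤ w l)
    {F : V →ₗ[ℂ] V} (hF : LinearMap.adjoint F = F)
    (htr : LinearMap.trace ℂ V (F ∘ₗ F) = k * LinearMap.trace ℂ V F)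
    (hle : k * ∑ i, (inner ℂ (b i) (F (b i))).re ≤ ∑ i, w i * (inner ℂ (b i) (F (b i))).re)
    (hR : ∀ l, w l ≠ 0 → (inner ℂ (b l) (F (b l))).re - k =
      (1 / 4 : ℝ) * ∑ i, ‖LinearMap.adjoint (μ (g i)) (b l)‖ ^ 2 -
      (1 / 2 : ℝ) * ∑ i, ‖μ (g i) (b l)‖ ^ 2) :
    (∀ i, F (b i) = (w i : ℂ) • b i) ∧
    ∀ i j l, inner ℂ (b l) (μ (b i) (b j)) ≠ 0 → w l = w i + w j := by
  have h1 : ∑ l, w l * ((inner ℂ (b l) (F (b l))).re - k) =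
      (1 / 4 : ℝ) * ∑ i, ∑ j, ∑ l, (w l - w i - w j) * ‖inner ℂ (b l) (μ (b i) (b j))‖ ^ 2 := by
    rw [← sum_weight_ricci halt g b w]
    refine Finset.sum_congr rfl fun l _ => ?_
    by_cases hl : w l = 0
    · rw [hl, zero_mul, zero_mul]
    · rw [hR l hl]
  have hnn : ∀ i j l, 0 ≤ (w l - w i - w j) * ‖inner ℂ (b l) (μ (b i) (b j))‖ ^ 2 := by
    intro i j l
    by_cases h : inner ℂ (b l) (μ (b i) (b j)) = 0
    · simp [h]
    · have := hadapt i j l h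
      exact mul_nonneg (by linarith) (by positivity)
  have h2 : ∑ i, ‖F (b i)‖ ^ 2 = k * ∑ i, (inner ℂ (b i) (F (b i))).re := by
    rw [LinearMap.trace_eq_sum_inner _ b, LinearMap.trace_eq_sum_inner _ b] at htr
    have := congrArg Complex.re htr
    rw [Complex.re_ofReal_mul, Complex.re_sum, Complex.re_sum] at this
    rw [← this]
    refine Finset.sum_congr rfl fun i _ => ?_
    have h3 : inner ℂ (b i) ((F ∘ₗ F) (b i)) = inner ℂ (F (b i)) (F (b i)) := by
      conv_rhs => rw [← LinearMap.adjoint_inner_right, hF]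
      rfl
    rw [h3, inner_self_eq_norm_sq_to_K]
    norm_cast
  have h3 : ∀ i, ‖F (b i) - (w i : ℂ) • b i‖ ^ 2 =
      ‖F (b i)‖ ^ 2 - 2 * (w i * (inner ℂ (b i) (F (b i))).re) + w i ^ 2 := by
    intro i
    rw [@norm_sub_sq ℂ, inner_smul_right, ← inner_conj_symm, norm_smul, b.norm_eq_one]
    simp only [RCLike.re_to_complex, Complex.re_ofReal_mul, Complex.conj_re, mul_one,
      Complex.norm_real, Real.norm_eq_abs, sq_abs]
  have h4 : ∑ i, ‖F (b i) - (w i : ℂ) • b i‖ ^ 2 = ∑ i, ‖F (b i)‖ ^ 2 -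
      2 * ∑ i, w i * (inner ℂ (b i) (F (b i))).re + ∑ i, w i ^ 2 := by
    simp only [h3, Finset.sum_add_distrib, Finset.sum_sub_distrib, Finset.mul_sum]
  have h5 : ∑ l, w l * ((inner ℂ (b l) (F (b l))).re - k) =
      ∑ i, w i * (inner ℂ (b i) (F (b i))).re - k * ∑ i, w i := by
    rw [Finset.mul_sum, ← Finset.sum_sub_distrib]
    exact Finset.sum_congr rfl fun i _ => by ring
  have h6 : 0 ≤ ∑ i, ∑ j, ∑ l, (w l - w i - w j) * ‖inner ℂ (b l) (μ (b i) (b j))‖ ^ 2 :=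
    Finset.sum_nonneg fun i _ => Finset.sum_nonneg fun j _ => Finset.sum_nonneg fun l _ => hnn i j l
  have h7 : 0 ≤ ∑ i, ‖F (b i) - (w i : ℂ) • b i‖ ^ 2 :=
    Finset.sum_nonneg fun i _ => by positivity
  constructor
  · intro i
    have h8 : ∑ i, ‖F (b i) - (w i : ℂ) • b i‖ ^ 2 = 0 := by linarith
    have := (Finset.sum_eq_zero_iff_of_nonneg fun i _ => by positivity).1 h8 i (Finset.mem_univ i)
    simpa [sub_eq_zero] using this
  · intro i j l hc
    have h8 : ∑ i, ∑ j, ∑ l, (w l - w i - w j) * ‖inner ℂ (b l) (μ (b i) (b j))‖ ^ 2 = 0 := by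
      linarith
    have h9 := (Finset.sum_eq_zero_iff_of_nonneg fun i _ => Finset.sum_nonneg fun j _ =>
      Finset.sum_nonneg fun l _ => hnn i j l).1 h8 i (Finset.mem_univ i)
    have h10 := (Finset.sum_eq_zero_iff_of_nonneg fun j _ =>
      Finset.sum_nonneg fun l _ => hnn i j l).1 h9 j (Finset.mem_univ j)
    have h11 := (Finset.sum_eq_zero_iff_of_nonneg fun l _ => hnn i j l).1 h10 l (Finset.mem_univ l)
    rcases mul_eq_zero.1 h11 with h | h
    · linarith
    · exact absurd (by simpa using h) hc

end ComplexOptimal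

section ComplexRicci

universe v

variable {V : Type v} [NormedAddCommGroup V] [InnerProductSpace ℂ V] [FiniteDimensional ℂ V]
  {κ : Type*} [Fintype κ]

omit [FiniteDimensional ℂ V] in
lemma ext_of_orthonormalBasis (b : OrthonormalBasis κ ℂ V) {x y : V}
    (h : ∀ l, inner ℂ (b l) x = inner ℂ (b l) y) : x = y := by
  rw [← b.sum_repr' x, ← b.sum_repr' y]
  simp only [h]

omit [FiniteDimensional ℂ V] in
lemma isDerivC_of_basis {ι : Type*} {μ : V →ₗ[ℂ] V →ₗ[ℂ] V} (b : Module.Basis ι ℂ V)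
    {F : V →ₗ[ℂ] V} (h : ∀ i j, F (μ (b i) (b j)) = μ (F (b i)) (b j) + μ (b i) (F (b j))) :
    IsDerivC μ F := by
  have : μ.compr₂ F = μ ∘ₗ F + μ.compl₂ F := by
    refine b.ext fun i => b.ext fun j => ?_
    simpa using h i j
  intro x y
  have := LinearMap.congr_fun₂ this x y
  simpa using this

theorem isDerivC_of_ricci {μ : V →ₗ[ℂ] V →ₗ[ℂ] V} (halt : ∀ x, μ x x = 0)
    (hjac : ∀ x, IsDerivC μ (μ x)) {W : Submodule ℂ V} (hW : ∀ x y, μ x y ∈ W) {k : ℝ} (hk : 0 < k)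
    (g : OrthonormalBasis κ ℂ V) {ψ : V →ₗ[ℂ] V} (hψ : IsDerivC μ ψ) (hψW : ∀ x, ψ x ∈ W)
    {F : V →ₗ[ℂ] V} (hF : LinearMap.adjoint F = F)
    (hFψ : ∀ x, (inner ℂ x (F x)).re = (inner ℂ x (ψ x)).re)
    (htr : LinearMap.trace ℂ V (F ∘ₗ F) = k * LinearMap.trace ℂ V F)
    (hR : ∀ v ∈ W, (inner ℂ v (F v)).re - k * ‖v‖ ^ 2 =
      (1 / 4 : ℝ) * ∑ i, ‖LinearMap.adjoint (μ (g i)) v‖ ^ 2 -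
      (1 / 2 : ℝ) * ∑ i, ‖μ (g i) v‖ ^ 2) :
    IsDerivC μ F ∧ (∀ x ∈ Wᗮ, F x = 0) ∧ ∀ x y z, F z = 0 → inner ℂ z (μ x (F y)) = 0 := by
  have hskew : ∀ x y, μ x y = -μ y x := fun x y => by
    have := halt (x + y)
    simp only [map_add, LinearMap.add_apply, halt, zero_add, add_zero] at this
    exact eq_neg_of_add_eq_zero_right this
  let ν : W →ₗ[ℂ] W →ₗ[ℂ] W := LinearMap.mk₂ ℂ (fun x y => ⟨μ x y, hW _ _⟩)
    (fun x y z => Subtype.ext (by simp)) (fun c x y => Subtype.ext (by simp))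
    (fun x y z => Subtype.ext (by simp)) (fun c x y => Subtype.ext (by simp))
  have hν : ∀ x y, (ν x y : V) = μ x y := fun _ _ => rfl
  have hder : ∀ {X : V →ₗ[ℂ] V} (hX : IsDerivC μ X) (hXW : ∀ x ∈ W, X x ∈ W),
      IsDerivC ν (X.restrict hXW) := fun hX hXW x y => Subtype.ext (by
    simp only [LinearMap.coe_restrict_apply, hν, Submodule.coe_add]
    exact hX x y)
  obtain ⟨f, u, hu0, husum, hadapt, hX⟩ := exists_optimal_orthonormalBasis (W := W) rfl ν
    (fun x => Subtype.ext (halt x)) (fun x => hder (hjac x) fun y _ => hW x y) hk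
  obtain ⟨b, hbl, hbr⟩ := exists_orthonormalBasis_sum f (stdOrthonormalBasis ℂ Wᗮ)
  set w : _ → ℝ := Sum.elim u (fun _ => 0) with hw
  have hbW : ∀ i, b (Sum.inl i) ∈ W := fun i => by rw [hbl]; exact (f i).2
  have hbW' : ∀ i, b (Sum.inr i) ∈ Wᗮ := fun i => by rw [hbr]; exact Subtype.prop _
  have hin : ∀ i, ∀ x ∈ W, inner ℂ (b (Sum.inr i)) x = 0 := fun i x hx =>
    (Submodule.mem_orthogonal' W _).1 (hbW' i) x hx
  have hadW : ∀ x, (∀ j l, inner ℂ (b (Sum.inl l)) (μ x (b (Sum.inl j))) ≠ 0 → u j ≤ u l) := by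
    intro x j l h
    refine (hX _ (hder (hjac x) fun y _ => hW x y)).1 j l ?_
    rw [hbl, hbl] at h
    exact h
  have hadapt' : ∀ i j l, inner ℂ (b l) (μ (b i) (b j)) ≠ 0 → w i + w j ≤ w l := by
    rintro i j (l | l) h
    · rcases i with i | i <;> rcases j with j | j <;>
        simp only [hw, Sum.elim_inl, Sum.elim_inr, zero_add, add_zero]
      · rw [hbl, hbl, hbl] at h
        exact hadapt i j l h
      · rw [hskew, inner_neg_right, neg_ne_zero] at h
        exact hadW _ _ _ h
      · exact hadW _ _ _ h
      · exact hu0 l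
    · exact absurd (hin l _ (hW _ _)) h
  have hFr : ∀ i, (inner ℂ (b (Sum.inr i)) (F (b (Sum.inr i)))).re = 0 := fun i => by
    rw [hFψ, hin i _ (hψW _), Complex.zero_re]
  have hle : k * ∑ i, (inner ℂ (b i) (F (b i))).re ≤
      ∑ i, w i * (inner ℂ (b i) (F (b i))).re := by
    have h1 := (hX _ (hder hψ fun y _ => hψW y)).2
    have h2 : ∀ i, (inner ℂ (f i) (ψ.restrict (fun y _ => hψW y) (f i))).re =
        (inner ℂ (b (Sum.inl i)) (F (b (Sum.inl i)))).re := fun i => by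
      rw [hFψ, hbl]
      rfl
    simp only [h2] at h1
    simpa only [Fintype.sum_sum_type, hFr, Finset.sum_const_zero, mul_zero, add_zero, hw,
      Sum.elim_inl] using h1
  obtain ⟨hFb, hgr⟩ := eq_weights_of_ricci halt g b w (k := k)
    (by simpa [hw] using husum) hadapt' hF htr hle (by
      rintro (l | l) hl
      · have := hR _ (hbW l)
        rwa [b.norm_eq_one, one_pow, mul_one] at this
      · exact absurd rfl hl)
  have hw0 : ∀ i, 0 ≤ w i := by
    rintro (i | i)
    · exact hu0 i
    · exact le_rfl
  have hFin : ∀ l x, inner ℂ (b l) (F x) = w l * inner ℂ (b l) x := fun l x => by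
    rw [← LinearMap.adjoint_inner_left, hF, hFb, inner_smul_left, Complex.conj_ofReal]
  refine ⟨isDerivC_of_basis b.toBasis fun i j => ?_, fun x hx => ?_, fun x y z hz => ?_⟩
  · simp only [OrthonormalBasis.coe_toBasis]
    refine ext_of_orthonormalBasis b fun l => ?_
    simp only [hFin, hFb, map_smul, LinearMap.smul_apply,
      inner_add_right, inner_smul_right]
    by_cases h : inner ℂ (b l) (μ (b i) (b j)) = 0
    · simp [h]
    · rw [hgr i j l h]
      push_cast
      ring
  · refine ext_of_orthonormalBasis b fun l => ?_
    rw [hFin, inner_zero_right]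
    rcases l with l | l
    · rw [(Submodule.mem_orthogonal W _).1 hx _ (hbW l), mul_zero]
    · simp [hw]
  · have h1 : ∀ l, w l ≠ 0 → inner ℂ z (b l) = 0 := fun l hl => by
      have := hFin l z
      rw [hz, inner_zero_right, eq_comm, mul_eq_zero] at this
      rw [← inner_conj_symm, this.resolve_left (by exact_mod_cast hl), map_zero]
    have h2 : ∀ i j, inner ℂ z (μ (b i) (F (b j))) = 0 := fun i j => by
      rw [← b.sum_inner_mul_inner]
      refine Finset.sum_eq_zero fun l _ => ?_
      rw [hFb, map_smul, inner_smul_right]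
      by_cases hj : w j = 0
      · simp [hj]
      by_cases h : inner ℂ (b l) (μ (b i) (b j)) = 0
      · simp [h]
      · rw [h1 l, zero_mul]
        have := hgr i j l h
        have := (hw0 j).lt_of_ne' hj
        linarith [hw0 i]
    have h3 : (μ.compl₂ F).compr₂ (innerₛₗ ℂ z) = 0 :=
      b.toBasis.ext fun i => b.toBasis.ext fun j => by simpa using h2 i j
    have := LinearMap.congr_fun₂ h3 x y
    simpa using this

end ComplexRicci

section Complexification

universe v

variable {E : Type v} [NormedAddCommGroup E] [InnerProductSpace ℝ E] [FiniteDimensional ℝ E]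

variable (E) in
/-- A model of the complexification of `E`. -/
abbrev Cx : Type := EuclideanSpace ℂ (Fin (Module.finrank ℝ E))

variable (E) in
/-- The standard basis of the complexification. -/
def cxB : OrthonormalBasis (Fin (Module.finrank ℝ E)) ℂ (Cx E) := EuclideanSpace.basisFun _ ℂ

/-- The embedding of `E` in its complexification. -/
def cxJ : E →ₗ[ℝ] Cx E := (stdONB E).toBasis.constr ℝ (fun i => cxB E i)

/-- The complexification of an operator. -/
def cx (T : E →ₗ[ℝ] E) : Cx E →ₗ[ℂ] Cx E :=
  (cxB E).toBasis.constr ℂ (fun i => cxJ (T (stdONB E i)))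

/-- The complexification of a bilinear map. -/
def cx₂ (μ : E →ₗ[ℝ] E →ₗ[ℝ] E) : Cx E →ₗ[ℂ] Cx E →ₗ[ℂ] Cx E :=
  (cxB E).toBasis.constr ℂ (fun i => cx (μ (stdONB E i)))

lemma cxJ_basis (i) : cxJ (stdONB E i) = cxB E i := by
  have := (stdONB E).toBasis.constr_basis ℝ (fun i => cxB E i) i
  rwa [OrthonormalBasis.coe_toBasis] at this

lemma cx_basis (T : E →ₗ[ℝ] E) (i) : cx T (cxB E i) = cxJ (T (stdONB E i)) := by
  have := (cxB E).toBasis.constr_basis ℂ (fun i => cxJ (T (stdONB E i))) i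
  rwa [OrthonormalBasis.coe_toBasis] at this

lemma cx₂_basis (μ : E →ₗ[ℝ] E →ₗ[ℝ] E) (i) : cx₂ μ (cxB E i) = cx (μ (stdONB E i)) := by
  have := (cxB E).toBasis.constr_basis ℂ (fun i => cx (μ (stdONB E i))) i
  rwa [OrthonormalBasis.coe_toBasis] at this

lemma cx_ext {Z : Type*} [AddCommGroup Z] [Module ℂ Z] {S T : Cx E →ₗ[ℂ] Z}
    (h : ∀ x, S (cxJ x) = T (cxJ x)) : S = T :=
  (cxB E).toBasis.ext fun i => by
    have := h (stdONB E i)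
    rwa [cxJ_basis] at this

lemma cx_cxJ (T : E →ₗ[ℝ] E) (x : E) : cx T (cxJ x) = cxJ (T x) := by
  have : (cx T).restrictScalars ℝ ∘ₗ cxJ = cxJ ∘ₗ T := by
    refine (stdONB E).toBasis.ext fun i => ?_
    simp only [OrthonormalBasis.coe_toBasis, LinearMap.comp_apply, cxJ_basis,
      LinearMap.restrictScalars_apply, cx_basis]
  exact LinearMap.congr_fun this x

lemma cx_add (S T : E →ₗ[ℝ] E) : cx (S + T) = cx S + cx T :=
  cx_ext fun x => by simp only [cx_cxJ, LinearMap.add_apply, map_add]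

lemma cx_smul (t : ℝ) (T : E →ₗ[ℝ] E) : cx (t • T) = (t : ℂ) • cx T :=
  cx_ext fun x => by
    simp only [cx_cxJ, LinearMap.smul_apply, map_smul, Complex.coe_smul]

lemma cx_sum {ι : Type*} (s : Finset ι) (f : ι → E →ₗ[ℝ] E) :
    cx (∑ i ∈ s, f i) = ∑ i ∈ s, cx (f i) :=
  cx_ext fun x => by simp only [cx_cxJ, LinearMap.sum_apply, map_sum]

lemma cx_comp (S T : E →ₗ[ℝ] E) : cx (S ∘ₗ T) = cx S ∘ₗ cx T :=
  cx_ext fun x => by simp only [cx_cxJ, LinearMap.comp_apply]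

lemma cx₂_cxJ (μ : E →ₗ[ℝ] E →ₗ[ℝ] E) (x : E) : cx₂ μ (cxJ x) = cx (μ x) := by
  rw [← (stdONB E).sum_repr' x]
  simp only [map_sum, map_smul, cxJ_basis, cx_sum, cx_smul, ← Complex.coe_smul, cx₂_basis]

lemma inner_cxJ (x y : E) : inner ℂ (cxJ x) (cxJ y) = (⟪x, y⟫ : ℂ) := by
  have h : ∀ x : E, ∀ i, inner ℂ (cxB E i) (cxJ x) = (⟪stdONB E i, x⟫ : ℂ) := fun x i => by
    conv_lhs => rw [← (stdONB E).sum_repr' x]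
    simp only [map_sum, map_smul, cxJ_basis, ← Complex.coe_smul, inner_sum, inner_smul_right,
      (cxB E).inner_eq_ite]
    simp
  rw [← (cxB E).sum_inner_mul_inner, ← (stdONB E).sum_inner_mul_inner]
  push_cast
  refine Finset.sum_congr rfl fun i _ => ?_
  rw [← inner_conj_symm, h, h, Complex.conj_ofReal, real_inner_comm]

lemma cxJ_eq_zero {x : E} (h : cxJ x = 0) : x = 0 := by
  have := inner_cxJ x x
  rw [h, inner_zero_left] at this
  exact inner_self_eq_zero.1 (by exact_mod_cast this.symm)

lemma adjoint_cx (T : E →ₗ[ℝ] E) : LinearMap.adjoint (cx T) = cx (transp T) := by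
  refine cx_ext fun x => ext_of_orthonormalBasis (cxB E) fun i => ?_
  rw [LinearMap.adjoint_inner_right, ← cxJ_basis, cx_cxJ, cx_cxJ, inner_cxJ, inner_cxJ,
    transp_inner_right]

lemma trace_cx (T : E →ₗ[ℝ] E) : LinearMap.trace ℂ (Cx E) (cx T) = LinearMap.trace ℝ E T := by
  rw [LinearMap.trace_eq_sum_inner _ (cxB E), LinearMap.trace_eq_sum_inner _ (stdONB E)]
  push_cast
  exact Finset.sum_congr rfl fun i _ => by rw [← cxJ_basis, cx_cxJ, inner_cxJ]

variable {μ : E →ₗ[ℝ] E →ₗ[ℝ] E}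

lemma cx_isDerivC {X : E →ₗ[ℝ] E} (hX : IsDeriv μ X) : IsDerivC (cx₂ μ) (cx X) :=
  isDerivC_of_basis (cxB E).toBasis fun i j => by
    simp only [OrthonormalBasis.coe_toBasis, ← cxJ_basis, cx_cxJ, cx₂_cxJ, hX _ _, map_add]

theorem isDeriv_of_ricci (hLie : IsLieBracket μ) {n : Submodule ℝ E} (hn : ∀ x y, μ x y ∈ n)
    {k : ℝ} (hk : 0 < k) {ψ : E →ₗ[ℝ] E} (hψ : IsDeriv μ ψ) (hψn : ∀ x, ψ x ∈ n)
    (htr : LinearMap.trace ℝ E (symPart ψ ∘ₗ symPart ψ) = k * LinearMap.trace ℝ E (symPart ψ))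
    (hR : ∀ x ∈ n, symPart ψ x = k • x + Rop μ x) :
    IsDeriv μ (symPart ψ) ∧ (∀ x ∈ nᗮ, symPart ψ x = 0) ∧
    ∀ x y z, symPart ψ z = 0 → ⟪z, μ x (symPart ψ y)⟫ = 0 := by
  set F := symPart ψ with hF
  have hskew : ∀ v w, cx₂ μ v w = -cx₂ μ w v := by
    have : cx₂ μ = -(cx₂ μ).flip := cx_ext fun x => cx_ext fun y => by
      simp only [LinearMap.neg_apply, LinearMap.flip_apply, cx₂_cxJ, cx_cxJ]
      rw [hLie.skew, map_neg]
    intro v w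
    conv_lhs => rw [this]
    rfl
  have halt : ∀ v, cx₂ μ v v = 0 := fun v => by
    have h : (2 : ℂ) • cx₂ μ v v = 0 := by
      rw [two_smul]
      exact add_eq_zero_iff_eq_neg.2 (hskew v v)
    exact (smul_eq_zero.1 h).resolve_left two_ne_zero
  have hjac : ∀ v, IsDerivC (cx₂ μ) (cx₂ μ v) := by
    intro v x y
    rw [← (cxB E).sum_repr' v]
    simp only [map_sum, map_smul, LinearMap.sum_apply, LinearMap.smul_apply, cx₂_basis,
      cx_isDerivC (hLie.isDeriv_ad (stdONB E _)) x y, smul_add, Finset.sum_add_distrib]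
  set P := projL n with hP
  have hPn : ∀ x ∈ n, P x = x := fun x hx => projL_of_mem hx
  have hPm : ∀ x, P x ∈ n := fun x => Subtype.prop _
  set W : Submodule ℂ (Cx E) := LinearMap.range (cx P) with hWdef
  have hmemcx : ∀ T : E →ₗ[ℝ] E, (∀ x, T x ∈ n) → ∀ v, cx T v ∈ W := fun T hT v => by
    refine ⟨cx T v, ?_⟩
    rw [← LinearMap.comp_apply, ← cx_comp]
    congr 2
    exact LinearMap.ext fun x => hPn _ (hT x)
  have hW : ∀ v w, cx₂ μ v w ∈ W := by
    intro v w
    rw [← (cxB E).sum_repr' v]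
    simp only [map_sum, map_smul, LinearMap.sum_apply, LinearMap.smul_apply, cx₂_basis]
    exact Submodule.sum_mem _ fun i _ => Submodule.smul_mem _ _ (hmemcx _ (hn _) w)
  have hFt : transp F = F := transp_symPart ψ
  have hFadj : LinearMap.adjoint (cx F) = cx F := by rw [adjoint_cx, hFt]
  have hFψ : ∀ v, (inner ℂ v (cx F v)).re = (inner ℂ v (cx ψ v)).re := by
    intro v
    rw [hF, symPart, cx_smul, cx_add, ← adjoint_cx, LinearMap.smul_apply, LinearMap.add_apply,
      inner_smul_right, inner_add_right, LinearMap.adjoint_inner_right, ← inner_conj_symm (cx ψ v),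
      Complex.re_ofReal_mul, Complex.add_re, Complex.conj_re]
    ring
  have hRic : ∀ v, (inner ℂ v (cx (Rop μ) v)).re =
      (1 / 4 : ℝ) * ∑ i, ‖LinearMap.adjoint (cx₂ μ (cxB E i)) v‖ ^ 2 -
      (1 / 2 : ℝ) * ∑ i, ‖cx₂ μ (cxB E i) v‖ ^ 2 := by
    intro v
    have h1 : ∀ T : Cx E →ₗ[ℂ] Cx E, (inner ℂ v (T (LinearMap.adjoint T v))).re =
        ‖LinearMap.adjoint T v‖ ^ 2 := fun T => by
      rw [← LinearMap.adjoint_inner_left, inner_self_eq_norm_sq_to_K]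
      norm_cast
    have h2 : ∀ T : Cx E →ₗ[ℂ] Cx E, (inner ℂ v (LinearMap.adjoint T (T v))).re =
        ‖T v‖ ^ 2 := fun T => by
      rw [LinearMap.adjoint_inner_right, inner_self_eq_norm_sq_to_K]
      norm_cast
    simp only [Rop, cx_add, cx_smul, cx_sum, cx_comp, ← adjoint_cx, LinearMap.add_apply,
      LinearMap.smul_apply, LinearMap.sum_apply, LinearMap.comp_apply, inner_add_right,
      inner_smul_right, inner_sum, Complex.add_re, Complex.re_ofReal_mul, Complex.re_sum, h1, h2,
      cx₂_basis]
    ring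
  have hRW : ∀ v ∈ W, (inner ℂ v (cx F v)).re - k * ‖v‖ ^ 2 =
      (1 / 4 : ℝ) * ∑ i, ‖LinearMap.adjoint (cx₂ μ (cxB E i)) v‖ ^ 2 -
      (1 / 2 : ℝ) * ∑ i, ‖cx₂ μ (cxB E i) v‖ ^ 2 := by
    rintro _ ⟨v, rfl⟩
    rw [← hRic]
    have h1 : cx F ∘ₗ cx P = (k : ℂ) • cx P + cx (Rop μ) ∘ₗ cx P := by
      rw [← cx_comp, ← cx_comp, ← cx_smul, ← cx_add]
      congr 1
      exact LinearMap.ext fun x => hR _ (hPm x)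
    have h2 : cx F (cx P v) = (k : ℂ) • cx P v + cx (Rop μ) (cx P v) := LinearMap.congr_fun h1 v
    rw [h2, inner_add_right, inner_smul_right, inner_self_eq_norm_sq_to_K, Complex.add_re,
      Complex.re_ofReal_mul]
    have h3 : ((‖cx P v‖ : ℂ) ^ 2).re = ‖cx P v‖ ^ 2 := by norm_cast
    erw [h3]
    ring
  obtain ⟨hd, h0, hi⟩ := isDerivC_of_ricci halt hjac hW hk (cxB E) (cx_isDerivC hψ) (hmemcx ψ hψn)
    hFadj hFψ (by rw [← cx_comp, trace_cx, trace_cx, htr]; push_cast; rfl) hRW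
  refine ⟨fun x y => ?_, fun x hx => ?_, fun x y z hz => ?_⟩
  · have := hd (cxJ x) (cxJ y)
    simp only [cx₂_cxJ, cx_cxJ, ← map_add] at this
    rw [← sub_eq_zero, ← map_sub] at this
    exact sub_eq_zero.1 (cxJ_eq_zero this)
  · refine cxJ_eq_zero ?_
    rw [← cx_cxJ]
    refine h0 _ ((Submodule.mem_orthogonal' W _).2 ?_)
    rintro _ ⟨v, rfl⟩
    rw [← LinearMap.adjoint_inner_left, adjoint_cx, cx_cxJ]
    have : transp P x = 0 := ext_inner_right ℝ fun y => by
      rw [transp_inner_left, inner_zero_left]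
      exact (Submodule.mem_orthogonal' n x).1 hx _ (hPm y)
    rw [this, map_zero, inner_zero_left]
  · have := hi (cxJ x) (cxJ y) (cxJ z) (by rw [cx_cxJ, hz, map_zero])
    rw [cx_cxJ, cx₂_cxJ, cx_cxJ, inner_cxJ] at this
    exact_mod_cast this

end Complexification

section IdealCompression

universe v

variable {E : Type v} [NormedAddCommGroup E] [InnerProductSpace ℝ E] [FiniteDimensional ℝ E]
  {μ : E →ₗ[ℝ] E →ₗ[ℝ] E}

/-- The linear map `y ↦ (μ y)ᵗ x`. -/
def coadjointL (μ : E →ₗ[ℝ] E →ₗ[ℝ] E) (x : E) : E →ₗ[ℝ] E where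
  toFun y := transp (μ y) x
  map_add' y z := by rw [map_add, transp_add, LinearMap.add_apply]
  map_smul' t y := by rw [map_smul, transp_smul, LinearMap.smul_apply, RingHom.id_apply]

lemma inner_projL_left (p : Submodule ℝ E) (x y : E) : ⟪projL p x, y⟫ = ⟪x, projL p y⟫ := by
  rw [← transp_inner_left, transp_projL]

lemma inner_comp_transp_self (T : E →ₗ[ℝ] E) (x : E) :
    ⟪(T ∘ₗ transp T) x, x⟫ = ‖transp T x‖ ^ 2 := by
  rw [LinearMap.comp_apply, ← transp_inner_right, real_inner_self_eq_norm_sq]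

lemma inner_transp_comp_self (T : E →ₗ[ℝ] E) (x : E) :
    ⟪(transp T ∘ₗ T) x, x⟫ = ‖T x‖ ^ 2 := by
  rw [LinearMap.comp_apply, transp_inner_left, real_inner_self_eq_norm_sq]

lemma coadjointL_apply (μ : E →ₗ[ℝ] E →ₗ[ℝ] E) (x y : E) :
    coadjointL μ x y = transp (μ y) x := rfl

lemma sum_norm_projL_coadjoint_sq (hμ : ∀ x y, μ x y = -μ y x) (p q : Submodule ℝ E) (x : E) :
    ∑ j, ‖projL q (transp (μ (projL p (stdONB E j))) x)‖ ^ 2 =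
      ∑ j, ‖projL p (transp (μ (projL q (stdONB E j))) x)‖ ^ 2 := by
  have h : ∀ (p q : Submodule ℝ E) (j), ‖projL q (transp (μ (projL p (stdONB E j))) x)‖ ^ 2 =
      ∑ l, ‖⟪μ (projL p (stdONB E j)) (projL q (stdONB E l)), x⟫‖ ^ 2 := fun p q j => by
    rw [← (stdONB E).sum_sq_norm_inner_right]
    refine Finset.sum_congr rfl fun l _ => ?_
    rw [← transp_projL, transp_inner_right, transp_inner_right]
    rw [transp_projL]
  simp only [h]
  rw [Finset.sum_comm]
  refine Finset.sum_congr rfl fun l _ => Finset.sum_congr rfl fun j _ => ?_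
  rw [hμ, inner_neg_left, norm_neg]

/-- The bracket compressed to the subspace `p`. -/
def compressed (μ : E →ₗ[ℝ] E →ₗ[ℝ] E) (p : Submodule ℝ E) : E →ₗ[ℝ] E →ₗ[ℝ] E :=
  μ.compl₁₂ (projL p) (projL p)

lemma compressed_apply (p : Submodule ℝ E) (x y : E) :
    compressed μ p x y = μ (projL p x) (projL p y) := rfl

lemma transp_compressed {p : Submodule ℝ E} (x y : E) :
    transp (compressed μ p x) y = projL p (transp (μ (projL p x)) y) := by
  have : compressed μ p x = μ (projL p x) ∘ₗ projL p := rfl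
  rw [this, transp_comp, transp_projL]
  rfl

/-- The Ricci-type operator of a Lie algebra decomposed as a subalgebra and an ideal. -/
lemma inner_Rop_projL (hμ : ∀ x y, μ x y = -μ y x) {p : Submodule ℝ E}
    (hsub : ∀ x ∈ pᗮ, ∀ y ∈ pᗮ, μ x y ∈ pᗮ) (x : E) :
    ⟪Rop μ (projL p x), projL p x⟫ = ⟪Rop (compressed μ p) (projL p x), projL p x⟫ +
      (1 / 2 : ℝ) * ∑ j, (‖projL p (transp (μ (projL pᗮ (stdONB E j))) (projL p x))‖ ^ 2 -
        ‖μ (projL pᗮ (stdONB E j)) (projL p x)‖ ^ 2) := by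
  set X := projL p x with hX
  have h1 : ∑ j, ‖μ (stdONB E j) X‖ ^ 2 = ∑ j, ‖μ (projL p (stdONB E j)) X‖ ^ 2 +
      ∑ j, ‖μ (projL pᗮ (stdONB E j)) X‖ ^ 2 := sum_norm_sq_eq_projL_add (μ.flip X) p
  have h2 : ∑ j, ‖transp (μ (stdONB E j)) X‖ ^ 2 =
      ∑ j, ‖transp (μ (projL p (stdONB E j))) X‖ ^ 2 +
      ∑ j, ‖transp (μ (projL pᗮ (stdONB E j))) X‖ ^ 2 :=
    sum_norm_sq_eq_projL_add (coadjointL μ X) p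
  have h3 : ∀ j, ‖transp (μ (projL pᗮ (stdONB E j))) X‖ ^ 2 =
      ‖projL p (transp (μ (projL pᗮ (stdONB E j))) X)‖ ^ 2 := fun j => by
    rw [norm_sq_eq_projL_add p, add_eq_left]
    have : projL pᗮ (transp (μ (projL pᗮ (stdONB E j))) X) = 0 := by
      refine ext_inner_right ℝ fun y => ?_
      rw [inner_projL_left, transp_inner_left, inner_zero_left]
      exact (Submodule.mem_orthogonal p _).1 (hsub _ (projL_mem _ _) _ (projL_mem _ _)) _
        (projL_mem p x)
    rw [this, norm_zero, zero_pow two_ne_zero]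
  have h4 : ∑ j, ‖transp (μ (projL p (stdONB E j))) X‖ ^ 2 =
      ∑ j, ‖projL p (transp (μ (projL p (stdONB E j))) X)‖ ^ 2 +
      ∑ j, ‖projL p (transp (μ (projL pᗮ (stdONB E j))) X)‖ ^ 2 := by
    rw [← sum_norm_projL_coadjoint_sq hμ p pᗮ, ← Finset.sum_add_distrib]
    exact Finset.sum_congr rfl fun j _ => norm_sq_eq_projL_add p _
  rw [inner_Rop_self, inner_Rop_self, h1, h2, Finset.sum_congr rfl fun j _ => h3 j, h4,
    Finset.sum_sub_distrib]
  simp only [transp_compressed, compressed_apply]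
  rw [hX, projL_projL]
  ring

/-- The Ricci-type operator of the ideal on which the solsoliton derivation is nondegenerate. -/
theorem Rop_compressed_eq (hLie : IsLieBracket μ) {F : E →ₗ[ℝ] E} (hFt : transp F = F)
    (hF : IsDeriv μ F) (hideal : ∀ x y z, F z = 0 → ⟪z, μ x (F y)⟫ = 0) {c : ℝ}
    (htr : LinearMap.trace ℝ E (F ∘ₗ F) = -c * LinearMap.trace ℝ E F)
    (hR : ∀ x ∈ LinearMap.range F, c • x + F x = Rop μ x) :
    Rop (compressed μ (LinearMap.range F)) = c • projL (LinearMap.range F) + F := by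
  set p := LinearMap.range F with hp
  set P := projL p with hPdef
  have hker : ∀ x, x ∈ pᗮ ↔ F x = 0 := fun x => by
    rw [Submodule.mem_orthogonal']
    constructor
    · intro h
      refine ext_inner_right ℝ fun y => ?_
      rw [← hFt, transp_inner_left, inner_zero_left]
      exact h _ ⟨y, rfl⟩
    · rintro h _ ⟨y, rfl⟩
      rw [← transp_inner_left, hFt, h, inner_zero_left]
  have hFp : ∀ x, F x ∈ p := fun x => ⟨x, rfl⟩
  have hPF : ∀ x, P (F x) = F x := fun x => projL_of_mem (hFp x)
  have hFP : ∀ x, F (P x) = F x := fun x => by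
    conv_rhs => rw [← projL_add_projL_orthogonal p x, map_add, (hker _).1 (projL_mem pᗮ x), add_zero]
  have hid : ∀ x, ∀ y ∈ p, μ x y ∈ p := by
    rintro x _ ⟨y, rfl⟩
    rw [← Submodule.orthogonal_orthogonal p, Submodule.mem_orthogonal]
    exact fun z hz => hideal x y z ((hker z).1 hz)
  have hsub : ∀ x ∈ pᗮ, ∀ y ∈ pᗮ, μ x y ∈ pᗮ := fun x hx y hy => by
    rw [hker, hF, (hker x).1 hx, (hker y).1 hy]
    simp
  have hPP : ∀ x, P (P x) = P x := projL_projL p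
  have hPm : ∀ x, P x ∈ p := projL_mem p
  have hPt : transp P = P := transp_projL p
  set ν := compressed μ p with hν
  have hνapp : ∀ x y, ν x y = μ (P x) (P y) := fun _ _ => rfl
  have hνskew : ∀ x y, ν x y = -ν y x := fun x y => hLie.skew _ _
  have hνP : ∀ x, ν x ∘ₗ P = ν x := fun x => LinearMap.ext fun y => by
    rw [LinearMap.comp_apply, hνapp, hνapp, hPP]
  have hPν : ∀ x, P ∘ₗ ν x = ν x := fun x => LinearMap.ext fun y =>
    projL_of_mem (hid _ _ (hPm y))
  have hνtP : ∀ x, transp (ν x) ∘ₗ P = transp (ν x) := fun x => by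
    conv_rhs => rw [← hPν, transp_comp, hPt]
  set M := Rop ν with hM
  have hMt : transp M = M := transp_Rop ν
  have hsum : ∀ f : Fin (Module.finrank ℝ E) → E →ₗ[ℝ] E, (∑ i, f i) ∘ₗ P = ∑ i, f i ∘ₗ P :=
    fun f => by ext x; simp
  have hMP : M ∘ₗ P = M := by
    simp only [hM, Rop, LinearMap.add_comp, LinearMap.smul_comp, hsum, LinearMap.comp_assoc, hνP,
      hνtP]
  set A : Fin (Module.finrank ℝ E) → E →ₗ[ℝ] E := fun j => μ (projL pᗮ (stdONB E j)) ∘ₗ P with hA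
  have hAd : ∀ j, IsDeriv ν (A j) := fun j x y => by
    simp only [hνapp, hA, LinearMap.comp_apply]
    rw [projL_of_mem (hid _ _ (hPm y)), projL_of_mem (hid _ _ (hPm y)),
      projL_of_mem (hid _ _ (hPm x)), hLie.2]
  have hFd : IsDeriv ν F := fun x y => by
    rw [hνapp, hνapp, hνapp, hF, hPF, hPF, hFP, hFP]
  have hmain : c • P + F = M + (1 / 2 : ℝ) • ∑ j, (A j ∘ₗ transp (A j) - transp (A j) ∘ₗ A j) := by
    refine eq_of_inner_self_eq ?_ ?_ fun x => ?_
    · rw [transp_add, transp_smul, hPt, hFt]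
    · simp only [transp_add, hMt, transp_smul, transp_sum, transp_sub, transp_comp, transp_transp]
    · have h1 : ⟪(c • P + F) x, x⟫ = ⟪Rop μ (P x), P x⟫ := by
        rw [← hR _ (hPm x), ← transp_inner_left, hPt, map_add, map_smul, hPP, hPF, hFP]
        rfl
      have h2 : ⟪M (P x), P x⟫ = ⟪M x, x⟫ := by
        have h3 : M (P x) = M x := LinearMap.congr_fun hMP x
        rw [h3, ← transp_inner_right, hMt, h3, real_inner_comm]
      have h3 : ∀ j, ⟪(A j ∘ₗ transp (A j) - transp (A j) ∘ₗ A j) x, x⟫ =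
          ‖P (transp (μ (projL pᗮ (stdONB E j))) (P x))‖ ^ 2 -
            ‖μ (projL pᗮ (stdONB E j)) (P x)‖ ^ 2 := fun j => by
        have h4 : ∀ y, transp (A j) y = P (transp (μ (projL pᗮ (stdONB E j))) y) := fun y => by
          rw [hA, transp_comp, hPt]
          rfl
        have h5 : transp (A j) ∘ₗ P = transp (A j) := by
          have : P ∘ₗ A j = A j := LinearMap.ext fun y => projL_of_mem (hid _ _ (hPm y))
          conv_rhs => rw [← this, transp_comp, hPt]
        rw [LinearMap.sub_apply, inner_sub_left, inner_comp_transp_self, inner_transp_comp_self,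
          ← h5, LinearMap.comp_apply, h4]
        rfl
      rw [h1, inner_Rop_projL hLie.skew hsub, LinearMap.add_apply, inner_add_left,
        LinearMap.smul_apply, real_inner_smul_left, LinearMap.sum_apply, sum_inner, h2]
      simp only [h3]
      rfl
  have hpos : 0 ≤ LinearMap.trace ℝ E
      (M ∘ₗ ∑ j, (A j ∘ₗ transp (A j) - transp (A j) ∘ₗ A j)) := by
    have h1 : M ∘ₗ ∑ j, (A j ∘ₗ transp (A j) - transp (A j) ∘ₗ A j) =
        ∑ j, M ∘ₗ (A j ∘ₗ transp (A j) - transp (A j) ∘ₗ A j) := by ext x; simp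
    rw [h1, map_sum]
    exact Finset.sum_nonneg fun j _ => trace_Rop_comp_commutator_nonneg hνskew (hAd j)
  have htr0 : LinearMap.trace ℝ E (∑ j, (A j ∘ₗ transp (A j) - transp (A j) ∘ₗ A j)) = 0 := by
    rw [map_sum]
    refine Finset.sum_eq_zero fun j _ => ?_
    rw [map_sub, LinearMap.trace_comp_comm', sub_self]
  have hMF : LinearMap.trace ℝ E (M ∘ₗ F) = 0 := trace_Rop_comp_eq_zero hνskew hFd
  have e1 := congrArg (LinearMap.trace ℝ E) hmain
  have e2 := congrArg (fun T => LinearMap.trace ℝ E (M ∘ₗ T)) hmain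
  simp only [LinearMap.comp_add, LinearMap.comp_smul, map_add, map_smul, hMP, hMF, htr0,
    smul_eq_mul, mul_zero, add_zero] at e1 e2
  have hPFc : P ∘ₗ F = F := LinearMap.ext hPF
  have hFPc : F ∘ₗ P = F := LinearMap.ext hFP
  have hPPc : P ∘ₗ P = P := LinearMap.ext hPP
  have hPM : LinearMap.trace ℝ E (P ∘ₗ M) = LinearMap.trace ℝ E M := by
    rw [LinearMap.trace_comp_comm', hMP]
  have hFM : LinearMap.trace ℝ E (F ∘ₗ M) = 0 := by
    rw [LinearMap.trace_comp_comm', hMF]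
  rw [← sub_eq_zero]
  refine eq_zero_of_trace_comp_self ?_ ?_
  · rw [transp_sub, transp_add, transp_smul, hPt, hFt, hMt]
  · simp only [LinearMap.comp_add, LinearMap.comp_sub, LinearMap.sub_comp, LinearMap.add_comp,
      LinearMap.comp_smul, LinearMap.smul_comp, map_add, map_sub, map_smul, hPFc, hFPc, hPPc, hMP,
      hMF, hPM, hFM, htr, smul_eq_mul]
    rw [e1]
    linarith

end IdealCompression

section Center

section Algebraic

variable {E : Type*} [AddCommGroup E] [Module ℝ E] {μ : E →ₗ[ℝ] E →ₗ[ℝ] E}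

lemma IsLieBracket.apply_center (h : IsLieBracket μ) {x : E} (hx : x ∈ centerB μ) (y : E) :
    μ y x = 0 := by
  have hx' : μ x = 0 := hx
  rw [h.skew, hx', LinearMap.zero_apply, neg_zero]

lemma IsDeriv.map_center {F : E →ₗ[ℝ] E} (hF : IsDeriv μ F) {x : E} (hx : x ∈ centerB μ) :
    F x ∈ centerB μ := by
  have hx' : μ x = 0 := hx
  refine LinearMap.ext fun y => ?_
  have := hF x y
  simpa [hx'] using this.symm

end Algebraic

universe v

variable {E : Type v} [NormedAddCommGroup E] [InnerProductSpace ℝ E] [FiniteDimensional ℝ E]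
  {μ : E →ₗ[ℝ] E →ₗ[ℝ] E}

lemma transp_adOn (p : Submodule ℝ E) (x y : E) :
    transp (adOn μ p x) y = projL p (transp (μ x) y) := by
  rw [adOn, transp_comp, transp_projL]
  rfl

lemma inner_Rop_center (h : IsLieBracket μ) {x : E} (hx : x ∈ centerB μ) :
    ⟪Rop μ x, x⟫ = (1 / 4 : ℝ) * ∑ i, ‖transp (μ (stdONB E i)) x‖ ^ 2 := by
  simp [inner_Rop_self, h.apply_center hx]

lemma inner_Rop_compressed_center (h : IsLieBracket μ) {p : Submodule ℝ E} {x : E}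
    (hx : x ∈ centerB μ) (hxp : x ∈ p) :
    ⟪Rop (compressed μ p) x, x⟫ =
      (1 / 4 : ℝ) * ∑ i, ‖projL p (transp (μ (projL p (stdONB E i))) x)‖ ^ 2 := by
  simp [inner_Rop_self, transp_compressed, compressed_apply, projL_of_mem hxp, h.apply_center hx]

lemma inner_RopOn_center (h : IsLieBracket μ) {p : Submodule ℝ E} {x : E}
    (hx : x ∈ centerB μ) (hxp : x ∈ p) :
    ⟪RopOn μ p x, x⟫ =
      (1 / 4 : ℝ) * ∑ i, ‖projL p (transp (μ (projL p (stdONB E i))) x)‖ ^ 2 := by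
  have h1 : ∀ y, adOn μ p y x = 0 := fun y => by
    rw [adOn, LinearMap.comp_apply, projL_of_mem hxp, h.apply_center hx]
  have h2 := sum_norm_onbOf_sq (projL p ∘ₗ coadjointL μ x) p
  simp only [LinearMap.comp_apply, coadjointL_apply] at h2
  rw [← h2, RopOn, LinearMap.add_apply, inner_add_left, LinearMap.smul_apply, LinearMap.smul_apply,
    real_inner_smul_left, real_inner_smul_left, LinearMap.sum_apply, LinearMap.sum_apply, sum_inner,
    sum_inner]
  simp only [inner_transp_comp_self, inner_comp_transp_self, h1, transp_adOn]
  simp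

lemma sum_norm_projL_coadjoint_sq_mono {p q : Submodule ℝ E} (h : p ≤ q) (x : E) :
    ∑ i, ‖projL p (transp (μ (projL p (stdONB E i))) x)‖ ^ 2 ≤
      ∑ i, ‖projL q (transp (μ (projL q (stdONB E i))) x)‖ ^ 2 :=
  (Finset.sum_le_sum fun _ _ => norm_projL_le_of_le h _).trans
    (sum_norm_projL_sq_le (projL q ∘ₗ coadjointL μ x) h)

lemma le_range_of_injOn {F : E →ₗ[ℝ] E} {p : Submodule ℝ E} (hp : ∀ x ∈ p, F x ∈ p)
    (hinj : ∀ x ∈ p, F x = 0 → x = 0) : p ≤ LinearMap.range F := by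
  have h : Function.Injective (F.restrict hp) := by
    rw [← LinearMap.ker_eq_bot, LinearMap.ker_eq_bot']
    exact fun x hx => Subtype.ext (hinj x x.2 (congrArg Subtype.val hx))
  intro x hx
  obtain ⟨y, hy⟩ := LinearMap.injective_iff_surjective.1 h ⟨x, hx⟩
  exact ⟨y, congrArg Subtype.val hy⟩

theorem inner_deriv_eq_of_mem_center (hLie : IsLieBracket μ) (hsolv : IsSolvableB μ)
    {n : Submodule ℝ E} (hn : IsNilradical μ n) {c : ℝ} (hc : c < 0) {D : E →ₗ[ℝ] E}
    (hD : IsDeriv μ D) (hRic : Ric μ = c • LinearMap.id + D) {x : E} (hx : x ∈ centerB μ) :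
    ⟪D x, x⟫ = ⟪RopOn μ n x - c • x, x⟫ := by
  obtain ⟨hψ, hψn, hB, hR, htr⟩ := solsoliton_symPart hLie hsolv hn hD hRic
  have hR' : ∀ y ∈ n, c • y + symPart (μ (meanCurv μ) + D) y = Rop μ y := fun y hy => by
    have := LinearMap.congr_fun hR y
    simpa [hB y hy] using this
  obtain ⟨hF, hF0, hideal⟩ := isDeriv_of_ricci hLie (hn.bracket_mem hLie hsolv) (neg_pos.2 hc) hψ
    hψn htr fun y hy => by rw [← hR' y hy]; module
  have hFD : ⟪symPart (μ (meanCurv μ) + D) x, x⟫ = ⟪D x, x⟫ := by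
    rw [inner_symPart_self, LinearMap.add_apply, hLie.apply_center hx, zero_add]
  set F := symPart (μ (meanCurv μ) + D)
  have hFt : transp F = F := transp_symPart _
  have hpn : LinearMap.range F ≤ n := by
    rintro _ ⟨y, rfl⟩
    rw [← Submodule.orthogonal_orthogonal n, Submodule.mem_orthogonal]
    intro z hz
    rw [← transp_inner_left, hFt, hF0 z hz, inner_zero_left]
  have hxR : ∀ y ∈ centerB μ, c * ‖y‖ ^ 2 + ⟪F y, y⟫ = ⟪Rop μ y, y⟫ := fun y hy => by
    rw [← hR' y (hn.center_le hLie hy), inner_add_left, real_inner_smul_left,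
      real_inner_self_eq_norm_sq]
  have hxp : x ∈ LinearMap.range F := by
    refine le_range_of_injOn (fun _ => hF.map_center) (fun y hy hy0 => ?_) hx
    have h1 := hxR y hy
    rw [hy0, inner_zero_left, add_zero, inner_Rop_center hLie hy] at h1
    have h2 : 0 ≤ ∑ i, ‖transp (μ (stdONB E i)) y‖ ^ 2 := by positivity
    by_contra h0
    nlinarith [mul_neg_of_neg_of_pos hc (pow_pos (norm_pos_iff.2 h0) 2)]
  have hcomp := Rop_compressed_eq hLie hFt hF hideal htr fun y hy => hR' y (hpn hy)
  have h1 : ⟪Rop (compressed μ (LinearMap.range F)) x, x⟫ = ⟪Rop μ x, x⟫ := by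
    rw [hcomp, ← hxR x hx, LinearMap.add_apply, LinearMap.smul_apply, projL_of_mem hxp,
      inner_add_left, real_inner_smul_left, real_inner_self_eq_norm_sq]
  have h2 := sum_norm_projL_coadjoint_sq_mono (μ := μ) hpn x
  have h3 := sum_norm_projL_coadjoint_sq_mono (μ := μ) (le_top : n ≤ ⊤) x
  have htop : ∀ y : E, projL ⊤ y = y := fun y => projL_of_mem Submodule.mem_top
  simp only [htop] at h3
  rw [inner_Rop_compressed_center hLie hx hxp, inner_Rop_center hLie hx] at h1
  have h4 := hxR x hx
  rw [inner_Rop_center hLie hx] at h4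
  rw [inner_sub_left, inner_RopOn_center hLie hx (hn.center_le hLie hx), real_inner_smul_left,
    real_inner_self_eq_norm_sq, ← hFD]
  linarith

end Center

/-- for a solsoliton with `Ric = c I + D`, `c < 0`, the center `z(s)` is contained
in the nilradical `n`, and `⟨D X, X⟩ = ⟨D₁ X, X⟩` for every central `X`, where
`D₁ = Ric₁ - c I` on `n`.  In particular, if `D₁` is positive definite then `D` is injective on
the center. -/
theorem solsoliton_center_deriv
    {E : Type*} [NormedAddCommGroup E] [InnerProductSpace ℝ E] [FiniteDimensional ℝ E]
    (μ : E →ₗ[ℝ] E →ₗ[ℝ] E) (hLie : IsLieBracket μ) (hsolv : IsSolvableB μ)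
    (n : Submodule ℝ E) (hn : IsNilradical μ n)
    (c : ℝ) (hc : c < 0) (D : E →ₗ[ℝ] E) (hD : IsDeriv μ D)
    (hRic : Ric μ = c • LinearMap.id + D) :
    centerB μ ≤ n ∧
      (∀ X ∈ centerB μ, ⟪D X, X⟫ = ⟪RopOn μ n X - c • X, X⟫) ∧
      ((∀ X ∈ n, X ≠ 0 → 0 < ⟪RopOn μ n X - c • X, X⟫) →
        ∀ X ∈ centerB μ, X ≠ 0 → D X ≠ 0) := by
  have h := fun X hX => inner_deriv_eq_of_mem_center hLie hsolv hn hc hD hRic (x := X) hX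
  refine ⟨hn.center_le hLie, h, fun hpos X hX hX0 hDX => ?_⟩
  have h1 := hpos X (hn.center_le hLie hX) hX0
  rw [← h X hX, hDX, inner_zero_left] at h1
  exact lt_irrefl _ h1
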